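/- arXiv:2404.16742 — 2 statements merged into one kernel-verified Lean document; each statement's English description precedes it below -/
import Mathlib

section
/- Let W₁, W₂ be C² Z^d-periodic functions and let ρ₁, ρ₂ be classical solutions on [0,T] of the McKean–Vlasov equations with interaction potentials W₁ and W₂ respectively and the same initial probability density φ, and assume ρ₁ and ρ₂ are strictly positive and continuous on [0,T]×[0,1)^d. Then for every t ∈ [0,T]: H(ρ₁(t,·)|ρ₂(t,·)) ≤ (1/2) ∫₀ᵗ ∫_{[0,1)^d} |∇W₁*ρ₁(u,·)(x) − ∇W₂*ρ₂(u,·)(x)|² ρ₁(u,x) dx du. -/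
open MeasureTheory Real
noncomputable section

/-- The fundamental domain `[0,1)^d` of the torus `T^d`. -/
def cube (d : ℕ) : Set (Fin d → ℝ) := Set.univ.pi fun _ => Set.Ico (0:ℝ) 1

variable {d : ℕ}

/-- The `i`-th spatial partial derivative of `f` at `x`. -/
def pd (i : Fin d) (f : (Fin d → ℝ) → ℝ) (x : Fin d → ℝ) : ℝ :=
  fderiv ℝ f x (Pi.single i 1)

/-- The Laplacian of `f` at `x`. -/
def lap (f : (Fin d → ℝ) → ℝ) (x : Fin d → ℝ) : ℝ := ∑ i, pd i (pd i f) x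

/-- The divergence of a vector field `F` at `x`. -/
def divg (F : (Fin d → ℝ) → Fin d → ℝ) (x : Fin d → ℝ) : ℝ :=
  ∑ i, pd i (fun y => F y i) x

/-- The squared Euclidean norm of the gradient of `f` at `x`. -/
def gradSq (f : (Fin d → ℝ) → ℝ) (x : Fin d → ℝ) : ℝ := ∑ i, (pd i f x) ^ 2

/-- Convolution on the torus: `(f*g)(x) = ∫_{[0,1)^d} f(x-y) g(y) dy`. -/
def pconv (f g : (Fin d → ℝ) → ℝ) (x : Fin d → ℝ) : ℝ :=
  ∫ y in cube d, f (x - y) * g y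

/-- `ℤ^d`-periodicity of a function on `ℝ^d`. -/
def ZdPeriodic (f : (Fin d → ℝ) → ℝ) : Prop :=
  ∀ (x : Fin d → ℝ) (k : Fin d → ℤ), f (x + fun i => (k i : ℝ)) = f x

/-- A probability density on the torus: nonnegative, periodic, integral one over `[0,1)^d`. -/
def IsProbDensity (f : (Fin d → ℝ) → ℝ) : Prop :=
  ZdPeriodic f ∧ (∀ x, 0 ≤ f x) ∧ (∫ x in cube d, f x) = 1

/-- `‖W‖_{C²} ≤ M`: sup-norm bounds on `W` and all its partial derivatives up to order two. -/
def C2NormLE (W : (Fin d → ℝ) → ℝ) (M : ℝ) : Prop :=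
  ∀ x, |W x| ≤ M ∧ (∀ i, |pd i W x| ≤ M) ∧ (∀ i j, |pd i (pd j W) x| ≤ M)

/-- A classical solution on `[0,T]` of the McKean–Vlasov equation
`∂ρ/∂t = Δρ + ∇·(ρ ∇(W*ρ))` with initial condition `φ`:
periodic in space, `C¹` in time, `C²` in space, a probability density at each time. -/
def IsMVSolution (T : ℝ) (W φ : (Fin d → ℝ) → ℝ) (ρ : ℝ → (Fin d → ℝ) → ℝ) : Prop :=
  (∀ t ∈ Set.Icc (0:ℝ) T, ZdPeriodic (ρ t)) ∧
  (∀ x, ContDiffOn ℝ 1 (fun t => ρ t x) (Set.Icc (0:ℝ) T)) ∧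
  (∀ t ∈ Set.Icc (0:ℝ) T, ContDiff ℝ 2 (ρ t)) ∧
  ρ 0 = φ ∧
  (∀ t ∈ Set.Icc (0:ℝ) T, IsProbDensity (ρ t)) ∧
  (∀ t ∈ Set.Icc (0:ℝ) T, ∀ x, deriv (fun s => ρ s x) t =
    lap (ρ t) x + divg (fun y i => ρ t y * pd i (pconv W (ρ t)) y) x)

/-- Relative entropy `H(p|q) = ∫_{[0,1)^d} p log(p/q)`. -/
def relEnt (p q : (Fin d → ℝ) → ℝ) : ℝ :=
  ∫ x in cube d, p x * Real.log (p x / q x)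

/-- The `k`-th Fourier coefficient of a periodic function `f`. -/
def fCoeff (f : (Fin d → ℝ) → ℝ) (k : Fin d → ℤ) : ℂ :=
  ∫ x in cube d, (f x : ℂ) *
    Complex.exp (-(Complex.ofReal (2 * Real.pi) * Complex.I *
      Complex.ofReal (∑ i, (k i : ℝ) * x i)))

/-- Squared Euclidean norm `|k|²` of a frequency `k ∈ ℤ^d`. -/
def kSq (k : Fin d → ℤ) : ℝ := ∑ i, ((k i : ℝ)) ^ 2

/-- Squared Sobolev norm of order `s`: `‖f‖²_{H^s} = Σ_k (1+|k|²)^s |f̂(k)|²`. -/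
def sobSq (s : ℝ) (f : (Fin d → ℝ) → ℝ) : ℝ :=
  ∑' k : Fin d → ℤ, (1 + kSq k) ^ s * ‖fCoeff f k‖ ^ 2

section

open Set Filter Topology

lemma measurableSet_cube : MeasurableSet (cube d) :=
  MeasurableSet.univ_pi fun _ => measurableSet_Ico

lemma cube_subset_Icc : cube d ⊆ Icc 0 1 := fun _ hx =>
  ⟨fun i => (hx i (mem_univ i)).1, fun i => (hx i (mem_univ i)).2.le⟩

lemma volume_cube : volume (cube d) = 1 := by
  simp [cube, volume_pi, Measure.pi_pi]

instance : IsProbabilityMeasure ((volume : Measure (Fin d → ℝ)).restrict (cube d)) :=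
  ⟨by simp [volume_cube]⟩

lemma exists_add_mem_cube (x : Fin d → ℝ) :
    ∃ k : Fin d → ℤ, (x + fun i => (k i : ℝ)) ∈ cube d := by
  refine ⟨fun i => -⌊x i⌋, fun i _ => ?_⟩
  have h1 := Int.floor_le (x i)
  have h2 := Int.lt_floor_add_one (x i)
  simp only [Pi.add_apply, Int.cast_neg, mem_Ico]
  constructor <;> linarith

lemma ZdPeriodic.exists_bound {f : (Fin d → ℝ) → ℝ} (hf : ZdPeriodic f) (hc : Continuous f) :
    ∃ M, 0 ≤ M ∧ ∀ x, |f x| ≤ M := by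
  obtain ⟨M, hM⟩ := (isCompact_Icc (a := (0 : Fin d → ℝ)) (b := 1)).exists_bound_of_continuousOn
    hc.continuousOn
  refine ⟨max M 0, le_max_right _ _, fun x => ?_⟩
  obtain ⟨k, hk⟩ := exists_add_mem_cube x
  rw [← hf x k]
  exact (hM _ (cube_subset_Icc hk)).trans (le_max_left _ _)

lemma ZdPeriodic.pd {f : (Fin d → ℝ) → ℝ} (hf : ZdPeriodic f) (i : Fin d) :
    ZdPeriodic (pd i f) := fun x k => by
  have h : (fun y => f (y + fun i => (k i : ℝ))) = f := funext fun y => hf y k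
  conv_rhs => rw [← h]
  simp only [_root_.pd]
  rw [fderiv_comp_add_right]

lemma integrable_cube {f : (Fin d → ℝ) → ℝ} (hf : Continuous f) :
    Integrable f (volume.restrict (cube d)) :=
  (hf.continuousOn.integrableOn_compact isCompact_Icc).mono_set cube_subset_Icc

open scoped Pointwise in
lemma integral_cube_add {f : (Fin d → ℝ) → ℝ} (hf : ZdPeriodic f) (v : Fin d → ℝ) :
    ∫ x in cube d, f (x + v) = ∫ x in cube d, f x := by
  have hc : cube d = ZSpan.fundamentalDomain (Pi.basisFun ℝ (Fin d)) :=
    (ZSpan.fundamentalDomain_pi_basisFun).symm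
  have hfd := ZSpan.isAddFundamentalDomain' (Pi.basisFun ℝ (Fin d)) volume
  rw [← hc] at hfd
  have hfd2 := hfd.vadd_of_comm v
  have hinv : ∀ (g : (Submodule.span ℤ (Set.range (Pi.basisFun ℝ (Fin d)))).toAddSubgroup)
      (x : Fin d → ℝ), f (g +ᵥ x) = f x := by
    rintro ⟨g, hg⟩ x
    have hg' := (Module.Basis.mem_span_iff_repr_mem ℤ (Pi.basisFun ℝ (Fin d)) g).1 hg
    choose k hk using hg'
    have : g = fun i => (k i : ℝ) := by
      ext i; have := hk i; simpa using this.symm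
    change f (g + x) = f x
    rw [add_comm, this]
    exact hf x k
  have : Countable (Submodule.span ℤ (Set.range (Pi.basisFun ℝ (Fin d)))).toAddSubgroup :=
    inferInstanceAs (Countable (Submodule.span ℤ (Set.range (Pi.basisFun ℝ (Fin d)))))
  have : VAddInvariantMeasure
      (Submodule.span ℤ (Set.range (Pi.basisFun ℝ (Fin d)))).toAddSubgroup (Fin d → ℝ) volume :=
    inferInstance
  rw [hfd.setIntegral_eq hfd2 hinv]
  have := (measurePreserving_add_right (volume : Measure (Fin d → ℝ)) v).setIntegral_image_emb
    (measurableEmbedding_addRight v) f (cube d)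
  rw [← this]
  congr 2
  ext x
  simp only [Set.mem_vadd_set, Set.mem_image, vadd_eq_add, add_comm]

lemma hasFDerivAt_line {f : (Fin d → ℝ) → ℝ} {x : Fin d → ℝ} (i : Fin d) {s : ℝ}
    (hf : DifferentiableAt ℝ f (x + s • Pi.single i 1)) :
    HasDerivAt (fun s : ℝ => f (x + s • Pi.single i 1)) (pd i f (x + s • Pi.single i 1)) s := by
  have h1 : HasDerivAt (fun s : ℝ => x + s • (Pi.single i 1 : Fin d → ℝ)) (Pi.single i 1) s := by
    simpa using ((hasDerivAt_id s).smul_const (Pi.single i 1 : Fin d → ℝ)).const_add x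
  exact hf.hasFDerivAt.comp_hasDerivAt s h1

lemma integral_pd_eq_zero {f : (Fin d → ℝ) → ℝ} (hf : ZdPeriodic f) (i : Fin d)
    (hd : Differentiable ℝ f) (hc : Continuous (pd i f)) :
    ∫ x in cube d, pd i f x = 0 := by
  obtain ⟨M, -, hM⟩ := (hf.pd i).exists_bound hc
  have h := (hasDerivAt_integral_of_dominated_loc_of_deriv_le
    (μ := volume.restrict (cube d)) (F := fun s x => f (x + s • Pi.single i 1)) (x₀ := (0 : ℝ))
    (F' := fun s x => pd i f (x + s • Pi.single i 1)) (bound := fun _ => M) univ_mem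
    (Eventually.of_forall fun s => ?_) ?_ ?_ ?_ ?_ ?_).2
  · have h2 : (fun s : ℝ => ∫ x in cube d, f (x + s • Pi.single i 1)) =
        fun _ => ∫ x in cube d, f x := funext fun s => integral_cube_add hf _
    rw [h2] at h
    simpa using h.unique (hasDerivAt_const _ _)
  · exact (hd.continuous.comp (by fun_prop)).aestronglyMeasurable
  · exact integrable_cube (hd.continuous.comp (by fun_prop))
  · exact (hc.comp (by fun_prop)).aestronglyMeasurable
  · exact Eventually.of_forall fun x s _ => hM _
  · exact integrable_const _
  · exact Eventually.of_forall fun x s _ => hasFDerivAt_line i (hd _)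

lemma continuous_pd {f : (Fin d → ℝ) → ℝ} (hf : ContDiff ℝ 1 f) (i : Fin d) :
    Continuous (pd i f) :=
  (hf.continuous_fderiv one_ne_zero).clm_apply continuous_const

lemma contDiff_pd {f : (Fin d → ℝ) → ℝ} (hf : ContDiff ℝ 2 f) (i : Fin d) :
    ContDiff ℝ 1 (pd i f) :=
  (hf.fderiv_right (m := 1) (by norm_num)).clm_apply contDiff_const

lemma abs_pconv_le {f g : (Fin d → ℝ) → ℝ} {M N : ℝ} (hf : ∀ x, |f x| ≤ M) (hg : ∀ x, |g x| ≤ N)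
    (hM : 0 ≤ M) (x : Fin d → ℝ) : |pconv f g x| ≤ M * N := by
  have := norm_integral_le_of_norm_le_const (μ := volume.restrict (cube d)) (C := M * N)
    (f := fun y => f (x - y) * g y) (Eventually.of_forall fun y => by
      rw [norm_mul]; exact mul_le_mul (hf _) (hg _) (abs_nonneg _) hM)
  simpa [pconv] using this

lemma pconv_sub_pconv {f g h : (Fin d → ℝ) → ℝ} (hf : Continuous f) (hfp : ZdPeriodic f)
    (hg : Continuous g) (hh : Continuous h) (hhp : ZdPeriodic h) (x z : Fin d → ℝ) :
    pconv f h (x + z) - pconv f g x = pconv f (fun y => h (y + z) - g y) x := by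
  have h1 : pconv f h (x + z) = ∫ y in cube d, f (x - y) * h (y + z) := by
    rw [pconv, ← integral_cube_add (v := z)]
    · simp
    · intro y k
      change f (x + z - (y + _)) * h (y + _) = _
      rw [hhp]
      congr 1
      rw [← hfp (x + z - (y + fun i => (k i : ℝ))) k]
      congr 1
      abel
  rw [h1, pconv, ← integral_sub]
  · simp only [pconv, mul_sub]
  · exact integrable_cube (by fun_prop)
  · exact integrable_cube (by fun_prop)

lemma pconv_sub_left {f g : (Fin d → ℝ) → ℝ} (hf : Continuous f) (hg : Continuous g)
    (x z : Fin d → ℝ) :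
    pconv f g (x + z) - pconv f g x = pconv (fun y => f (y + z) - f y) g x := by
  rw [pconv, pconv, ← integral_sub]
  · simp only [pconv, ← sub_mul]
    congr 1; ext y; congr 3; abel
  · exact integrable_cube (by fun_prop)
  · exact integrable_cube (by fun_prop)

lemma ZdPeriodic.pconv {f : (Fin d → ℝ) → ℝ} (hf : ZdPeriodic f) (g : (Fin d → ℝ) → ℝ) :
    ZdPeriodic (pconv f g) := fun x k => by
  simp only [_root_.pconv]
  congr 1; ext y
  rw [← hf (x - y) k]; congr 2; abel

lemma continuous_pconv {f g : (Fin d → ℝ) → ℝ} (hf : Continuous f) (hfp : ZdPeriodic f)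
    (hg : Continuous g) (hgp : ZdPeriodic g) : Continuous (pconv f g) := by
  obtain ⟨M, hM0, hM⟩ := hfp.exists_bound hf
  obtain ⟨N, -, hN⟩ := hgp.exists_bound hg
  refine continuous_of_dominated (bound := fun _ => M * N)
    (fun x => (by fun_prop : Continuous fun y => f (x - y) * g y).aestronglyMeasurable)
    (fun x => Eventually.of_forall fun y => ?_) (integrable_const _)
    (Eventually.of_forall fun y => by fun_prop)
  rw [norm_mul]; exact mul_le_mul (hM _) (hN _) (abs_nonneg _) hM0

lemma exists_bound_fderiv {f : (Fin d → ℝ) → ℝ} (hf : ContDiff ℝ 1 f) (hfp : ZdPeriodic f) :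
    ∃ M, 0 ≤ M ∧ ∀ x, ‖fderiv ℝ f x‖ ≤ M := by
  obtain ⟨M, h0, hM⟩ := ZdPeriodic.exists_bound (f := fun x => ‖fderiv ℝ f x‖) (fun x k => by
      have h : (fun y => f (y + fun i => (k i : ℝ))) = f := funext fun y => hfp y k
      change ‖fderiv ℝ f (x + _)‖ = ‖fderiv ℝ f x‖
      conv_rhs => rw [← h]
      rw [fderiv_comp_add_right]) (hf.continuous_fderiv one_ne_zero).norm
  exact ⟨M, h0, fun x => by simpa using hM x⟩

lemma exists_lipschitz_bound {f : (Fin d → ℝ) → ℝ} (hf : ContDiff ℝ 1 f) (hfp : ZdPeriodic f) :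
    ∃ M, 0 ≤ M ∧ ∀ x z, |f (x + z) - f x| ≤ M * ‖z‖ := by
  obtain ⟨M, h0, hM⟩ := exists_bound_fderiv hf hfp
  refine ⟨M, h0, fun x z => ?_⟩
  have := convex_univ.norm_image_sub_le_of_norm_fderiv_le (𝕜 := ℝ) (f := f) (C := M)
    (fun x _ => hf.differentiable one_ne_zero x) (fun x _ => hM x) (mem_univ x) (mem_univ (x + z))
  simpa using this

lemma hasFDerivAt_pconv {f g : (Fin d → ℝ) → ℝ} (hf : ContDiff ℝ 1 f) (hfp : ZdPeriodic f)
    (hg : Continuous g) (hgp : ZdPeriodic g) (x : Fin d → ℝ) :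
    HasFDerivAt (pconv f g) (∫ y in cube d, g y • fderiv ℝ f (x - y)) x := by
  obtain ⟨M, hM0, hM⟩ := exists_bound_fderiv hf hfp
  obtain ⟨N, -, hN⟩ := hgp.exists_bound hg
  have hfc := hf.continuous
  have hfc' := hf.continuous_fderiv one_ne_zero
  refine hasFDerivAt_integral_of_dominated_of_fderiv_le (bound := fun _ => N * M)
    (F' := fun x y => g y • fderiv ℝ f (x - y)) univ_mem
    (Eventually.of_forall fun x =>
      (by fun_prop : Continuous fun y => f (x - y) * g y).aestronglyMeasurable)
    (integrable_cube (by fun_prop)) 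
    (by fun_prop : Continuous fun y => g y • fderiv ℝ f (x - y)).aestronglyMeasurable
    (Eventually.of_forall fun y x _ => ?_) (integrable_const _)
    (Eventually.of_forall fun y x _ => ?_)
  · rw [norm_smul]
    exact mul_le_mul (hN _) (hM _) (norm_nonneg _) ((abs_nonneg _).trans (hN 0))
  · have h := (hf.differentiable one_ne_zero (x - y)).hasFDerivAt.comp x
      ((hasFDerivAt_id x).sub_const y)
    exact h.mul_const (g y)

lemma pd_pconv {f g : (Fin d → ℝ) → ℝ} (hf : ContDiff ℝ 1 f) (hfp : ZdPeriodic f)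
    (hg : Continuous g) (hgp : ZdPeriodic g) (i : Fin d) :
    pd i (pconv f g) = pconv (pd i f) g := by
  ext x
  have hfc' := hf.continuous_fderiv one_ne_zero
  rw [pd, (hasFDerivAt_pconv hf hfp hg hgp x).fderiv, ContinuousLinearMap.integral_apply]
  · simp [pconv, pd, mul_comm]
  · exact ((by fun_prop : Continuous fun y => g y • fderiv ℝ f (x - y)).continuousOn.integrableOn_compact
      isCompact_Icc).mono_set cube_subset_Icc

lemma second_deriv_test {f : (Fin d → ℝ) → ℝ} (hf : ContDiff ℝ 2 f) {x : Fin d → ℝ}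
    (hx : ∀ y, f y ≤ f x) (i : Fin d) : pd i f x = 0 ∧ pd i (pd i f) x ≤ 0 := by
  have h0 : x + (0 : ℝ) • (Pi.single i 1 : Fin d → ℝ) = x := by simp
  set u : ℝ → ℝ := fun s => f (x + s • Pi.single i 1) with hu
  have hd1 : ∀ s, HasDerivAt u (pd i f (x + s • Pi.single i 1)) s := fun s =>
    hasFDerivAt_line i (hf.differentiable two_ne_zero _)
  have hdu : deriv u = fun s => pd i f (x + s • Pi.single i 1) := funext fun s => (hd1 s).deriv
  have hd2 : deriv (deriv u) 0 = pd i (pd i f) x := by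
    rw [hdu, (hasFDerivAt_line i ((contDiff_pd hf i).differentiable one_ne_zero _)).deriv, h0]
  have hmax : IsLocalMax u 0 := Eventually.of_forall fun s => by simp only [hu, h0]; exact hx _
  have hd10 : deriv u 0 = 0 := hmax.deriv_eq_zero
  refine ⟨by rw [hdu] at hd10; simpa [h0] using hd10, ?_⟩
  rw [← hd2]
  by_contra! hpos
  have hmin := isLocalMin_of_deriv_deriv_pos hpos hd10 (hd1 0).continuousAt
  have hconst : u =ᶠ[𝓝 0] fun _ => u 0 := by
    filter_upwards [hmin, hmax] with s h1 h2 using le_antisymm h2 h1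
  have : deriv (deriv u) 0 = 0 := by
    rw [hconst.deriv.deriv_eq]; simp
  exact lt_irrefl _ (hpos.trans_eq this)

/-- A first-touching-time comparison principle on a compact set. -/
lemma neg_of_first_touching {X : Type*} [TopologicalSpace X] [T2Space X] {S : Set X}
    (hS : IsCompact S) {T : ℝ} (Φ : ℝ → X → ℝ)
    (hc : ContinuousOn (fun p : ℝ × X => Φ p.1 p.2) (Icc 0 T ×ˢ S))
    (h0 : ∀ x ∈ S, Φ 0 x < 0)
    (h : ∀ t ∈ Ioo 0 T, ∀ x ∈ S, Φ t x = 0 → (∀ y ∈ S, Φ t y ≤ 0) →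
      ∃ D < 0, HasDerivAt (fun s => Φ s x) D t) :
    ∀ t ∈ Ico 0 T, ∀ x ∈ S, Φ t x < 0 := by
  by_contra! hcon
  obtain ⟨t₀, ht₀, x₀, hx₀, hpos⟩ := hcon
  have hsub : Icc 0 t₀ ×ˢ S ⊆ Icc 0 T ×ˢ S :=
    prod_mono (Icc_subset_Icc le_rfl ht₀.2.le) subset_rfl
  have hK : IsCompact (Icc 0 t₀ ×ˢ S) := isCompact_Icc.prod hS
  set Z := (Icc 0 t₀ ×ˢ S) ∩ (fun p : ℝ × X => Φ p.1 p.2) ⁻¹' Ici 0 with hZ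
  have hZc : IsCompact Z :=
    hK.of_isClosed_subset ((hc.mono hsub).preimage_isClosed_of_isClosed hK.isClosed isClosed_Ici)
      inter_subset_left
  obtain ⟨⟨t₁, x₁⟩, hm, hmin⟩ := hZc.exists_isMinOn
    ⟨(t₀, x₀), ⟨⟨⟨ht₀.1, le_rfl⟩, hx₀⟩, hpos⟩⟩ continuous_fst.continuousOn
  obtain ⟨⟨⟨ht₁, ht₁'⟩, hx₁⟩, hp₁⟩ := hm
  simp only at ht₁ ht₁' hx₁
  have hp₁ : 0 ≤ Φ t₁ x₁ := hp₁
  have hneg : ∀ s ∈ Ico 0 t₁, ∀ y ∈ S, Φ s y < 0 := fun s hs y hy => by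
    by_contra! hge
    have := hmin (a := (s, y)) ⟨⟨⟨hs.1, hs.2.le.trans ht₁'⟩, hy⟩, hge⟩
    exact absurd this (not_le.2 hs.2)
  have hpos1 : 0 < t₁ := lt_of_le_of_ne ht₁ fun he => by
    rw [← he] at hp₁; exact absurd (h0 x₁ hx₁) (not_lt.2 hp₁)
  have ht₁T : t₁ < T := ht₁'.trans_lt ht₀.2
  have hle : ∀ y ∈ S, Φ t₁ y ≤ 0 := fun y hy => by
    have hcy : ContinuousWithinAt (fun s => Φ s y) (Ico 0 t₁) t₁ := by
      have := (hc (t₁, y) ⟨⟨ht₁, ht₁T.le⟩, hy⟩).comp (f := fun s : ℝ => (s, y)) (s := Ico 0 t₁)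
        (x := t₁) (by fun_prop) (fun s hs => ⟨⟨hs.1, hs.2.le.trans ht₁T.le⟩, hy⟩)
      exact this
    have : t₁ ∈ closure (Ico 0 t₁) := by
      rw [closure_Ico hpos1.ne]; exact ⟨ht₁, le_rfl⟩
    have hne : (𝓝[Ico 0 t₁] t₁).NeBot := mem_closure_iff_nhdsWithin_neBot.1 this
    exact le_of_tendsto hcy (eventually_mem_nhdsWithin.mono fun s hs => (hneg s hs y hy).le)
  have heq : Φ t₁ x₁ = 0 := le_antisymm (hle x₁ hx₁) hp₁
  obtain ⟨D, hD, hder⟩ := h t₁ ⟨hpos1, ht₁T⟩ x₁ hx₁ heq hle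
  have hs := hasDerivWithinAt_iff_tendsto_slope' (s := Iio t₁) (by simp) |>.1
    hder.hasDerivWithinAt
  have : 0 ≤ D := by
    refine ge_of_tendsto hs ?_
    filter_upwards [Ioo_mem_nhdsLT hpos1] with s hs
    rw [slope_def_field, heq]
    exact (div_pos_of_neg_of_neg (by linarith [hneg s ⟨hs.1.le, hs.2⟩ x₁ hx₁]) (by linarith [hs.2])).le
  linarith

lemma hasDerivAt_pd {f : (Fin d → ℝ) → ℝ} {x : Fin d → ℝ} (i : Fin d)
    (hf : DifferentiableAt ℝ f x) :
    HasDerivAt (fun s : ℝ => f (x + s • Pi.single i 1)) (pd i f x) 0 := by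
  simpa using hasFDerivAt_line (x := x) i (s := 0) (by simpa using hf)

lemma pd_mul {f g : (Fin d → ℝ) → ℝ} {x : Fin d → ℝ} (i : Fin d)
    (hf : DifferentiableAt ℝ f x) (hg : DifferentiableAt ℝ g x) :
    pd i (fun y => f y * g y) x = pd i f x * g x + f x * pd i g x := by
  have := (hasDerivAt_pd i (hf.fun_mul hg)).unique ((hasDerivAt_pd i hf).fun_mul (hasDerivAt_pd i hg))
  simpa using this

lemma pd_sub {f g : (Fin d → ℝ) → ℝ} {x : Fin d → ℝ} (i : Fin d)
    (hf : DifferentiableAt ℝ f x) (hg : DifferentiableAt ℝ g x) :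
    pd i (fun y => f y - g y) x = pd i f x - pd i g x :=
  (hasDerivAt_pd i (hf.fun_sub hg)).unique ((hasDerivAt_pd i hf).fun_sub (hasDerivAt_pd i hg))

lemma pd_const_mul {f : (Fin d → ℝ) → ℝ} {x : Fin d → ℝ} (i : Fin d) (c : ℝ)
    (hf : DifferentiableAt ℝ f x) :
    pd i (fun y => c * f y) x = c * pd i f x :=
  (hasDerivAt_pd i (hf.const_mul c)).unique ((hasDerivAt_pd i hf).const_mul c)

lemma pd_comp_add (f : (Fin d → ℝ) → ℝ) (i : Fin d) (z : Fin d → ℝ) :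
    pd i (fun y => f (y + z)) = fun y => pd i f (y + z) := by
  ext y; simp only [pd]; rw [fderiv_comp_add_right]

lemma pd_comp_const_add (f : (Fin d → ℝ) → ℝ) (i : Fin d) (z : Fin d → ℝ) :
    pd i (fun y => f (z + y)) = fun y => pd i f (z + y) := by
  simp only [add_comm z, pd_comp_add]

lemma pd_sum_sq (i : Fin d) (z : Fin d → ℝ) :
    pd i (fun y : Fin d → ℝ => ∑ j, y j ^ 2) z = 2 * z i := by
  have h1 : HasDerivAt (fun s : ℝ => ∑ j, (z + s • (Pi.single i 1 : Fin d → ℝ)) j ^ 2)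
      (∑ j, 2 * z j * (Pi.single i 1 : Fin d → ℝ) j) 0 := by
    refine HasDerivAt.fun_sum fun j _ => ?_
    have : HasDerivAt (fun s : ℝ => (z + s • (Pi.single i 1 : Fin d → ℝ)) j)
        ((Pi.single i 1 : Fin d → ℝ) j) 0 := by
      simpa using ((hasDerivAt_id (0 : ℝ)).mul_const ((Pi.single i 1 : Fin d → ℝ) j)).const_add (z j)
    simpa using this.fun_pow 2
  rw [(hasDerivAt_pd i (f := fun y : Fin d → ℝ => ∑ j, y j ^ 2) (by fun_prop)).unique h1]
  simp [Pi.single_apply]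

lemma second_deriv_test_sub {f g : (Fin d → ℝ) → ℝ} (hf : ContDiff ℝ 2 f) (hg : ContDiff ℝ 2 g)
    {x : Fin d → ℝ} (hx : ∀ y, f y - g y ≤ f x - g x) (i : Fin d) :
    pd i f x = pd i g x ∧ pd i (pd i f) x ≤ pd i (pd i g) x := by
  have h := second_deriv_test (hf.sub hg) hx i
  have e : pd i (fun y => f y - g y) = fun y => pd i f y - pd i g y := funext fun y =>
    pd_sub i (hf.differentiable two_ne_zero y) (hg.differentiable two_ne_zero y)
  rw [e, pd_sub i ((contDiff_pd hf i).differentiable one_ne_zero x)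
    ((contDiff_pd hg i).differentiable one_ne_zero x)] at h
  exact ⟨sub_eq_zero.1 h.1, sub_nonpos.1 h.2⟩

lemma norm_sq_le_sum_sq (z : Fin d → ℝ) : ‖z‖ ^ 2 ≤ ∑ i, z i ^ 2 := by
  have h0 : 0 ≤ ∑ i, z i ^ 2 := Finset.sum_nonneg fun i _ => sq_nonneg _
  have : ‖z‖ ≤ √(∑ i, z i ^ 2) := by
    refine (pi_norm_le_iff_of_nonneg (sqrt_nonneg _)).2 fun i => ?_
    exact abs_le_sqrt (Finset.single_le_sum (f := fun i => z i ^ 2)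
      (fun i _ => sq_nonneg _) (Finset.mem_univ i))
  calc ‖z‖ ^ 2 ≤ √(∑ i, z i ^ 2) ^ 2 := by gcongr
    _ = _ := sq_sqrt h0

/-- The `i`-th component `∂ᵢW * p` of the drift generated by the density `p`. -/
def drift (W p : (Fin d → ℝ) → ℝ) (i : Fin d) : (Fin d → ℝ) → ℝ := pconv (pd i W) p

/-- The `i`-th diagonal second derivative `∂ᵢ∂ᵢW * p`. -/
def driftDeriv (W p : (Fin d → ℝ) → ℝ) (i : Fin d) : (Fin d → ℝ) → ℝ := pconv (pd i (pd i W)) p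

/-- The right-hand side of the expanded McKean–Vlasov equation at a density `p`. -/
def mvRhs (W p : (Fin d → ℝ) → ℝ) (x : Fin d → ℝ) : ℝ :=
  ∑ i, (pd i (pd i p) x + drift W p i x * pd i p x + p x * driftDeriv W p i x)

/-- Classical solutions of the expanded equation, with a common bound `K` for the density and the
first two derivatives of the potential. -/
structure BoundedSol (T K : ℝ) (W : (Fin d → ℝ) → ℝ) (ρ : ℝ → (Fin d → ℝ) → ℝ) : Prop where
  K_nonneg : 0 ≤ K
  smooth : ContDiff ℝ 2 W
  perW : ZdPeriodic W
  per : ∀ t ∈ Icc 0 T, ZdPeriodic (ρ t)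
  cd : ∀ t ∈ Icc 0 T, ContDiff ℝ 2 (ρ t)
  cont : ContinuousOn (fun p : ℝ × (Fin d → ℝ) => ρ p.1 p.2) (Icc 0 T ×ˢ univ)
  hasDeriv : ∀ t ∈ Ioo 0 T, ∀ x, HasDerivAt (fun s => ρ s x) (mvRhs W (ρ t) x) t
  bound : ∀ t ∈ Icc 0 T, ∀ x, |ρ t x| ≤ K
  boundW₁ : ∀ i x, |pd i W x| ≤ K
  boundW₂ : ∀ i x, |pd i (pd i W) x| ≤ K
  lipW : ∀ i x z, |pd i W (x + z) - pd i W x| ≤ K * ‖z‖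

lemma divg_eq {W p : (Fin d → ℝ) → ℝ} (hW : ContDiff ℝ 2 W) (hWp : ZdPeriodic W)
    (hp : ContDiff ℝ 2 p) (hpp : ZdPeriodic p) (x : Fin d → ℝ) :
    lap p x + divg (fun y i => p y * pd i (pconv W p) y) x = mvRhs W p x := by
  simp only [lap, divg, mvRhs, ← Finset.sum_add_distrib]
  refine Finset.sum_congr rfl fun i _ => ?_
  rw [pd_pconv (hW.of_le one_le_two) hWp hp.continuous hpp i]
  rw [pd_mul i (hp.differentiable two_ne_zero x)
    (hasFDerivAt_pconv (contDiff_pd hW i) (hWp.pd i) hp.continuous hpp x).differentiableAt]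
  rw [pd_pconv (contDiff_pd hW i) (hWp.pd i) hp.continuous hpp i]
  simp only [drift, driftDeriv]
  ring

lemma exists_common_bound {ι : Type*} [Finite ι] (f : ι → (Fin d → ℝ) → ℝ)
    (hp : ∀ i, ZdPeriodic (f i)) (hc : ∀ i, Continuous (f i)) :
    ∃ M, 0 ≤ M ∧ ∀ i x, |f i x| ≤ M := by
  cases nonempty_fintype ι
  choose M h0 hM using fun i => (hp i).exists_bound (hc i)
  exact ⟨∑ i, M i, Finset.sum_nonneg fun i _ => h0 i, fun i x => (hM i x).trans
    (Finset.single_le_sum (fun i _ => h0 i) (Finset.mem_univ i))⟩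

lemma IsMVSolution.exists_boundedSol {T : ℝ} {W φ : (Fin d → ℝ) → ℝ} {ρ : ℝ → (Fin d → ℝ) → ℝ}
    (h : IsMVSolution T W φ ρ) (hW : ContDiff ℝ 2 W) (hWp : ZdPeriodic W)
    (hc : ContinuousOn (fun p : ℝ × (Fin d → ℝ) => ρ p.1 p.2) (Icc 0 T ×ˢ univ)) :
    ∃ K, BoundedSol T K W ρ := by
  obtain ⟨hper, htime, hcd, -, -, hpde⟩ := h
  obtain ⟨K₁, h₁, hK₁⟩ := exists_common_bound (fun i => pd i W) (fun i => hWp.pd i)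
    (fun i => (contDiff_pd hW i).continuous)
  obtain ⟨K₂, h₂, hK₂⟩ := exists_common_bound (fun i => pd i (pd i W)) (fun i => (hWp.pd i).pd i)
    (fun i => continuous_pd (contDiff_pd hW i) i)
  choose K₃ h₃ hK₃ using fun i => exists_lipschitz_bound (contDiff_pd hW i) (hWp.pd i)
  have hS : ∀ i, K₃ i ≤ ∑ i, K₃ i := fun i =>
    Finset.single_le_sum (fun i _ => h₃ i) (Finset.mem_univ i)
  have hS0 : 0 ≤ ∑ i, K₃ i := Finset.sum_nonneg fun i _ => h₃ i
  obtain ⟨K₄, hK₄⟩ := ((isCompact_Icc (a := (0 : ℝ)) (b := T)).prod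
    (isCompact_Icc (a := (0 : Fin d → ℝ)) (b := 1))).exists_bound_of_continuousOn
    (hc.mono (prod_mono subset_rfl (subset_univ _)))
  refine ⟨K₁ + K₂ + ∑ i, K₃ i + |K₄|, ⟨by positivity, hW, hWp, hper, hcd, hc, ?_, ?_, ?_, ?_, ?_⟩⟩
  · intro t ht x
    have hdiff : DifferentiableAt ℝ (fun s => ρ s x) t :=
      ((htime x).contDiffAt (Icc_mem_nhds ht.1 ht.2)).differentiableAt one_ne_zero
    have ht' := Ioo_subset_Icc_self ht
    rw [← divg_eq hW hWp (hcd t ht') (hper t ht'), ← hpde t ht' x]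
    exact hdiff.hasDerivAt
  · intro t ht x
    obtain ⟨k, hk⟩ := exists_add_mem_cube x
    rw [← hper t ht x k]
    have := hK₄ (t, _) ⟨ht, cube_subset_Icc hk⟩
    rw [norm_eq_abs] at this
    linarith [le_abs_self K₄]
  · intro i x
    linarith [hK₁ i x, abs_nonneg K₄]
  · intro i x
    linarith [hK₂ i x, abs_nonneg K₄]
  · intro i x z
    refine (hK₃ i x z).trans (mul_le_mul_of_nonneg_right ?_ (norm_nonneg _))
    linarith [hS i, abs_nonneg K₄]

namespace BoundedSol

variable {T K : ℝ} {W : (Fin d → ℝ) → ℝ} {ρ : ℝ → (Fin d → ℝ) → ℝ}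

lemma abs_drift_le (h : BoundedSol T K W ρ) {t : ℝ} (ht : t ∈ Icc 0 T) (i : Fin d)
    (x : Fin d → ℝ) : |drift W (ρ t) i x| ≤ K * K :=
  abs_pconv_le (h.boundW₁ i) (h.bound t ht) h.K_nonneg x

lemma abs_driftDeriv_le (h : BoundedSol T K W ρ) {t : ℝ} (ht : t ∈ Icc 0 T) (i : Fin d)
    (x : Fin d → ℝ) : |driftDeriv W (ρ t) i x| ≤ K * K :=
  abs_pconv_le (h.boundW₂ i) (h.bound t ht) h.K_nonneg x

lemma abs_drift_add_sub_le (h : BoundedSol T K W ρ) {t : ℝ} (ht : t ∈ Icc 0 T) (i : Fin d)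
    (x z : Fin d → ℝ) : |drift W (ρ t) i (x + z) - drift W (ρ t) i x| ≤ K * ‖z‖ * K := by
  rw [drift, pconv_sub_left (contDiff_pd h.smooth i).continuous (h.cd t ht).continuous]
  exact abs_pconv_le (fun y => h.lipW i y z) (h.bound t ht)
    (mul_nonneg h.K_nonneg (norm_nonneg _)) x

lemma abs_drift_sub_le (h : BoundedSol T K W ρ) {t s D : ℝ} (ht : t ∈ Icc 0 T)
    (hs : s ∈ Icc 0 T) (hD : ∀ y, |ρ s y - ρ t y| ≤ D) (i : Fin d) (x : Fin d → ℝ) :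
    |drift W (ρ s) i x - drift W (ρ t) i x| ≤ K * D := by
  have := pconv_sub_pconv (contDiff_pd h.smooth i).continuous (h.perW.pd i)
    (h.cd t ht).continuous (h.cd s hs).continuous (h.per s hs) x 0
  simp only [add_zero] at this
  rw [drift, drift, this]
  exact abs_pconv_le (h.boundW₁ i) hD h.K_nonneg x

lemma abs_driftDeriv_sub_le (h : BoundedSol T K W ρ) {t s D : ℝ} (ht : t ∈ Icc 0 T)
    (hs : s ∈ Icc 0 T) {z : Fin d → ℝ} (hD : ∀ y, |ρ s (y + z) - ρ t y| ≤ D) (i : Fin d)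
    (x : Fin d → ℝ) :
    |driftDeriv W (ρ s) i (x + z) - driftDeriv W (ρ t) i x| ≤ K * D := by
  rw [driftDeriv, driftDeriv, pconv_sub_pconv (continuous_pd (contDiff_pd h.smooth i) i)
    ((h.perW.pd i).pd i) (h.cd t ht).continuous (h.cd s hs).continuous (h.per s hs) x z]
  exact abs_pconv_le (h.boundW₂ i) hD h.K_nonneg x

lemma mul_driftDeriv_sub_le (h : BoundedSol T K W ρ) {t s D : ℝ} (ht : t ∈ Icc 0 T)
    (hs : s ∈ Icc 0 T) {z : Fin d → ℝ} (hD : ∀ y, |ρ s (y + z) - ρ t y| ≤ D) (i : Fin d)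
    (x : Fin d → ℝ) :
    |ρ s (x + z) * driftDeriv W (ρ s) i (x + z) - ρ t x * driftDeriv W (ρ t) i x|
      ≤ 2 * K ^ 2 * D := by
  have h1 := h.abs_driftDeriv_sub_le ht hs hD i x
  have h2 := h.abs_driftDeriv_le hs i (x + z)
  have h3 := h.bound t ht x
  have h4 := hD x
  have hK := h.K_nonneg
  have hD0 : 0 ≤ D := (abs_nonneg _).trans h4
  calc _ = |(ρ s (x + z) - ρ t x) * driftDeriv W (ρ s) i (x + z) +
        ρ t x * (driftDeriv W (ρ s) i (x + z) - driftDeriv W (ρ t) i x)| := by ring_nf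
    _ ≤ |ρ s (x + z) - ρ t x| * |driftDeriv W (ρ s) i (x + z)| +
        |ρ t x| * |driftDeriv W (ρ s) i (x + z) - driftDeriv W (ρ t) i x| := by
      rw [← abs_mul, ← abs_mul]; exact abs_add_le _ _
    _ ≤ D * (K * K) + K * (K * D) := by gcongr
    _ = _ := by ring

lemma continuousOn_comp (h : BoundedSol T K W ρ) {X : Type*} [TopologicalSpace X] {S : Set X}
    {τ : X → ℝ} {y : X → Fin d → ℝ} (hτ : ContinuousOn τ S) (hy : ContinuousOn y S)
    (hmem : ∀ p ∈ S, τ p ∈ Icc 0 T) : ContinuousOn (fun p => ρ (τ p) (y p)) S :=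
  h.cont.comp (f := fun p => (τ p, y p)) (hτ.prodMk hy) fun p hp => ⟨hmem p hp, mem_univ _⟩

lemma sub_le_exp_mul (h : BoundedSol T K W ρ) {L A a : ℝ} (hA : 0 < A) (ha : 0 < a)
    (hAa : A * a = L ^ 2) (hL : 0 < L)
    (h0 : ∀ x z, |ρ 0 (x + z) - ρ 0 x| ≤ L * ‖z‖) {t : ℝ} (ht : t ∈ Ico 0 T) (x z : Fin d → ℝ) :
    ρ t (x + z) - ρ t x ≤ exp ((d * (4 * K ^ 2) + 1) * t) * (A + a * ∑ i, z i ^ 2) := by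
  set lam : ℝ := d * (4 * K ^ 2) + 1 with hlam
  have hK := h.K_nonneg
  have hlam0 : 0 ≤ lam := by positivity
  set B : (Fin d → ℝ) → ℝ := fun z => A + a * ∑ i, z i ^ 2 with hB
  have hBpos : ∀ z, 0 < B z := fun z => by
    have := Finset.sum_nonneg (s := Finset.univ) fun i _ => sq_nonneg (z i)
    simp only [hB]; positivity
  have hBn : ∀ z, A + a * ‖z‖ ^ 2 ≤ B z := fun z => by
    have := norm_sq_le_sum_sq z
    simp only [hB]; gcongr
  set R : ℝ := 2 * K / a + 1 with hR
  have hR1 : 1 ≤ R := by rw [hR]; have : 0 ≤ 2 * K / a := by positivity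
                         linarith
  set Φ : ℝ → (Fin d → ℝ) × (Fin d → ℝ) → ℝ := fun t p =>
    ρ t (p.1 + p.2) - ρ t p.1 - exp (lam * t) * B p.2 with hΦ
  set S : Set ((Fin d → ℝ) × (Fin d → ℝ)) := Icc 0 1 ×ˢ Metric.closedBall 0 R with hS
  have hglob : ∀ t ∈ Icc 0 T, (∀ p ∈ S, Φ t p ≤ 0) → ∀ x z, Φ t (x, z) ≤ 0 := by
    intro t ht hp x z
    by_cases hz : ‖z‖ ≤ R
    · obtain ⟨k, hk⟩ := exists_add_mem_cube x
      have := hp (_, z) ⟨cube_subset_Icc hk, by simpa using hz⟩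
      simp only [hΦ] at this ⊢
      rw [add_right_comm, h.per t ht, h.per t ht] at this
      exact this
    · push Not at hz
      have h1 := abs_le.1 (h.bound t ht (x + z))
      have h2 := abs_le.1 (h.bound t ht x)
      have h3 : 2 * K ≤ a * ‖z‖ ^ 2 := by
        have : 2 * K = a * (R - 1) := by rw [hR]; field_simp; ring
        rw [this]
        gcongr
        nlinarith
      have h4 : 1 ≤ exp (lam * t) := one_le_exp (mul_nonneg hlam0 ht.1)
      have h5 : B z ≤ exp (lam * t) * B z := le_mul_of_one_le_left (hBpos z).le h4
      simp only [hΦ]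
      linarith [hBn z]
  have hTpos : 0 < T := ht.1.trans_lt ht.2
  have key := neg_of_first_touching (S := S) (T := T)
    (isCompact_Icc.prod (isCompact_closedBall _ _)) Φ ?_ ?_ ?_
  · have := hglob t (Ico_subset_Icc_self ht) (fun p hp => (key t ht p hp).le) x z
    simp only [hΦ] at this
    linarith
  · refine ((h.continuousOn_comp (by fun_prop) (by fun_prop) fun p hp => hp.1).sub
      (h.continuousOn_comp (by fun_prop) (by fun_prop) fun p hp => hp.1)).sub ?_
    simp only [hB]
    fun_prop
  · rintro ⟨x, z⟩ -
    simp only [hΦ, mul_zero, exp_zero, one_mul]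
    have h1 := (le_abs_self _).trans (h0 x z)
    have h2 : L * ‖z‖ < A + a * ‖z‖ ^ 2 := by
      have : 0 < a * (A + a * ‖z‖ ^ 2 - L * ‖z‖) := by
        have e : a * (A + a * ‖z‖ ^ 2 - L * ‖z‖) = L ^ 2 + (a * ‖z‖) ^ 2 - L * (a * ‖z‖) := by
          rw [← hAa]; ring
        rw [e]
        nlinarith [sq_nonneg (L - 2 * (a * ‖z‖)), sq_nonneg (a * ‖z‖), pow_pos hL 2]
      have := pos_of_mul_pos_right this ha.le
      linarith
    linarith [hBn z]
  · rintro t ht ⟨x, z⟩ - heq hmax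
    have htI := Ioo_subset_Icc_self ht
    have hmax' := hglob t htI hmax
    have hcd := h.cd t htI
    have hcd1 : ∀ i, ContDiff ℝ 1 (pd i (ρ t)) := contDiff_pd hcd
    have hdiff : Differentiable ℝ (ρ t) := hcd.differentiable two_ne_zero
    set e := exp (lam * t) with he
    have he0 : 0 < e := exp_pos _
    have heq' : ρ t (x + z) - ρ t x = e * B z := by
      simp only [hΦ] at heq; linarith
    have hgrad2 : ∀ i, pd i (ρ t) (x + z) = e * (a * (2 * z i)) := fun i => by
      have hq : ContDiff ℝ 2 (fun y : Fin d → ℝ => ∑ j, y j ^ 2) := by fun_prop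
      have h1 := (second_deriv_test_sub (f := fun y => ρ t (x + y))
        (g := fun y => e * a * ∑ j, y j ^ 2) (x := z)
        (hcd.comp (by fun_prop)) (contDiff_const.mul hq) (fun y => ?_) i).1
      · rw [pd_const_mul (f := fun y : Fin d → ℝ => ∑ j, y j ^ 2) i _ (by fun_prop),
          pd_sum_sq, pd_comp_const_add] at h1
        linarith
      · have := hmax' x y
        simp only [hΦ, hB] at this heq'
        linarith
    have htest : ∀ i, pd i (ρ t) (x + z) = pd i (ρ t) x ∧
        pd i (pd i (ρ t)) (x + z) ≤ pd i (pd i (ρ t)) x := fun i => by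
      have h1 := second_deriv_test_sub (f := fun y => ρ t (y + z)) (g := ρ t) (x := x)
        (hcd.comp (by fun_prop)) hcd (fun y => ?_) i
      · simpa only [pd_comp_add] using h1
      · have := hmax' y z
        simp only [hΦ] at this
        linarith
    have hD : ∀ y, |ρ t (y + z) - ρ t y| ≤ e * B z := fun y => by
      have h1 := hmax' y z
      have h2 := hmax' (y + z) (-z)
      have h3 : B (-z) = B z := by simp [hB]
      simp only [hΦ, h3, add_neg_cancel_right] at h1 h2
      rw [abs_le]; constructor <;> linarith
    refine ⟨mvRhs W (ρ t) (x + z) - mvRhs W (ρ t) x - e * lam * B z, ?_, ?_⟩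
    · have hsum : mvRhs W (ρ t) (x + z) - mvRhs W (ρ t) x ≤ ∑ _i : Fin d, 4 * K ^ 2 * (e * B z) := by
        rw [mvRhs, mvRhs, ← Finset.sum_sub_distrib]
        refine Finset.sum_le_sum fun i _ => ?_
        have h1 := (le_abs_self _).trans (h.mul_driftDeriv_sub_le htI htI hD i x)
        have h2 : (drift W (ρ t) i (x + z) - drift W (ρ t) i x) * pd i (ρ t) (x + z)
            ≤ 2 * K ^ 2 * (e * B z) := by
          calc _ ≤ |drift W (ρ t) i (x + z) - drift W (ρ t) i x| * |pd i (ρ t) (x + z)| := by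
                rw [← abs_mul]; exact le_abs_self _
            _ ≤ (K * ‖z‖ * K) * (e * (a * (2 * ‖z‖))) := by
                gcongr
                · exact h.abs_drift_add_sub_le htI i x z
                · rw [hgrad2, abs_mul, abs_mul, abs_mul, abs_of_pos he0, abs_of_pos ha, abs_two]
                  gcongr
                  exact norm_le_pi_norm z i
            _ = 2 * K ^ 2 * (e * (a * ‖z‖ ^ 2)) := by ring
            _ ≤ _ := by
                gcongr
                linarith [hBn z]
        obtain ⟨h3, h4⟩ := htest i
        rw [← h3]
        linarith
      simp only [Finset.sum_const, Finset.card_univ, Fintype.card_fin, nsmul_eq_mul] at hsum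
      have : 0 < e * B z := mul_pos he0 (hBpos z)
      rw [hlam]
      linarith
    · have hexp : HasDerivAt (fun s => exp (lam * s)) (e * lam) t := by
        simpa using ((hasDerivAt_id t).const_mul lam).exp
      exact ((h.hasDeriv t ht (x + z)).sub (h.hasDeriv t ht x)).sub (hexp.mul_const _)

lemma exists_pd_bound (h : BoundedSol T K W ρ) (hT : 0 < T) :
    ∃ G, 0 ≤ G ∧ ∀ t ∈ Ico 0 T, ∀ i x, |pd i (ρ t) x| ≤ G := by
  have h0 : (0 : ℝ) ∈ Icc 0 T := ⟨le_rfl, hT.le⟩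
  obtain ⟨L', hL', hlip⟩ := exists_lipschitz_bound ((h.cd 0 h0).of_le one_le_two) (h.per 0 h0)
  set L := L' + 1 with hL
  have hLpos : 0 < L := by positivity
  have hlip' : ∀ x z, |ρ 0 (x + z) - ρ 0 x| ≤ L * ‖z‖ := fun x z =>
    (hlip x z).trans (by gcongr; linarith)
  set lam : ℝ := d * (4 * K ^ 2) + 1 with hlam
  have hlam0 : 0 ≤ lam := by positivity
  refine ⟨exp (lam * T) * (2 * L), by positivity, fun t ht i x => ?_⟩
  have hone : ∀ x (s : ℝ), s ≠ 0 → ρ t (x + s • Pi.single i 1) - ρ t x ≤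
      exp (lam * T) * (2 * L) * |s| := fun x s hs => by
    have hs' : 0 < |s| := abs_pos.2 hs
    have h1 := h.sub_le_exp_mul (A := L * |s|) (a := L / |s|) (by positivity) (by positivity)
      (by field_simp) hLpos hlip' ht x (s • Pi.single i 1)
    have h2 : ∑ j, (s • (Pi.single i 1 : Fin d → ℝ)) j ^ 2 = s ^ 2 := by
      simp [Pi.single_apply]
    rw [h2] at h1
    have h3 : L * |s| + L / |s| * s ^ 2 = 2 * L * |s| := by
      rw [← sq_abs]; field_simp; ring
    rw [h3] at h1
    refine h1.trans ?_
    rw [mul_assoc (exp _)]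
    gcongr
    exact ht.2.le
  have hder := hasDerivAt_pd i ((h.cd t (Ico_subset_Icc_self ht)).differentiable two_ne_zero x)
  refine hder.le_of_lip' (by positivity) (Eventually.of_forall fun s => ?_)
  rcases eq_or_ne s 0 with rfl | hs
  · simp
  have h1 := hone x s hs
  have h2 := hone (x + s • Pi.single i 1) (-s) (neg_ne_zero.2 hs)
  simp only [neg_smul, add_neg_cancel_right, abs_neg] at h2
  simp only [zero_smul, add_zero, sub_zero, norm_eq_abs]
  rw [abs_le]; constructor <;> linarith

end BoundedSol

lemma pd_sign_mul {f : (Fin d → ℝ) → ℝ} (hf : ContDiff ℝ 2 f) (σ : ℝ) (i : Fin d) :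
    pd i (fun y => σ * f y) = fun y => σ * pd i f y :=
  funext fun y => pd_const_mul i σ (hf.differentiable two_ne_zero y)

/-- The second derivative test at a point where `|f - g|` is maximal, `σ = ±1` being the sign of
`f - g` there. -/
lemma second_deriv_test_sign {f g : (Fin d → ℝ) → ℝ} (hf : ContDiff ℝ 2 f) (hg : ContDiff ℝ 2 g)
    {σ : ℝ} (hσ : σ ≠ 0) {x : Fin d → ℝ} (hx : ∀ y, σ * (f y - g y) ≤ σ * (f x - g x)) (i : Fin d) :
    pd i f x = pd i g x ∧ σ * pd i (pd i f) x ≤ σ * pd i (pd i g) x := by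
  have h := second_deriv_test_sub (f := fun y => σ * f y) (g := fun y => σ * g y)
    (contDiff_const.mul hf) (contDiff_const.mul hg) (x := x)
    (fun y => by simpa only [mul_sub] using hx y) i
  rw [pd_sign_mul hf, pd_sign_mul hg, 
    pd_const_mul i σ ((contDiff_pd hf i).differentiable one_ne_zero x),
    pd_const_mul i σ ((contDiff_pd hg i).differentiable one_ne_zero x)] at h
  exact ⟨mul_left_cancel₀ hσ h.1, h.2⟩

lemma isCompact_sign : IsCompact ({1, -1} : Set ℝ) := (Set.toFinite _).isCompact

namespace BoundedSol

variable {T K : ℝ} {W : (Fin d → ℝ) → ℝ} {ρ : ℝ → (Fin d → ℝ) → ℝ}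

lemma exists_initial_time_bound (h : BoundedSol T K W ρ) (hT : 0 < T) :
    ∃ C, 0 ≤ C ∧ ∀ t ∈ Ico 0 T, ∀ x, |ρ t x - ρ 0 x| ≤ C * t := by
  have hI0 : (0 : ℝ) ∈ Icc 0 T := ⟨le_rfl, hT.le⟩
  have hK := h.K_nonneg
  have hφ := h.cd 0 hI0
  have hφp := h.per 0 hI0
  obtain ⟨G₁, hG₁0, hG₁⟩ := exists_common_bound (fun i => pd i (ρ 0)) (fun i => hφp.pd i)
    (fun i => (contDiff_pd hφ i).continuous)
  obtain ⟨G₂, hG₂0, hG₂⟩ := exists_common_bound (fun i => pd i (pd i (ρ 0)))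
    (fun i => (hφp.pd i).pd i) (fun i => continuous_pd (contDiff_pd hφ i) i)
  set C : ℝ := d * (G₂ + K * K * G₁ + K * (K * K)) + 1 with hC
  refine ⟨C, by positivity, fun t₀ ht₀ x₀ => ?_⟩
  suffices hε : ∀ ε > 0, ∀ σ ∈ ({1, -1} : Set ℝ), σ * (ρ t₀ x₀ - ρ 0 x₀) - C * t₀ - ε < 0 by
    rw [abs_le]
    constructor
    · have := le_of_forall_pos_le_add (a := -(ρ t₀ x₀ - ρ 0 x₀)) (b := C * t₀) fun ε he => by
        have := hε ε he (-1) (by simp); linarith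
      linarith
    · exact le_of_forall_pos_le_add fun ε he => by
        have := hε ε he 1 (by simp); linarith
  intro ε he σ hσ
  obtain ⟨k₀, hk₀⟩ := exists_add_mem_cube x₀
  set Φ : ℝ → (Fin d → ℝ) → ℝ := fun t x => σ * (ρ t x - ρ 0 x) - C * t - ε with hΦ
  have hσ0 : σ ≠ 0 := by rcases hσ with rfl | rfl <;> norm_num
  have hσ1 : |σ| = 1 := by rcases hσ with rfl | rfl <;> norm_num
  have hper : ∀ t ∈ Icc 0 T, ∀ x (k : Fin d → ℤ), Φ t (x + fun i => (k i : ℝ)) = Φ t x :=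
    fun t ht x k => by simp only [hΦ]; rw [h.per t ht, hφp]
  have key := neg_of_first_touching (S := Icc (0 : Fin d → ℝ) 1) (T := T) isCompact_Icc Φ ?_ ?_ ?_
  · have := key t₀ ht₀ _ (cube_subset_Icc hk₀)
    rwa [hper t₀ (Ico_subset_Icc_self ht₀)] at this
  · have h1 := h.continuousOn_comp (S := Icc 0 T ×ˢ Icc (0 : Fin d → ℝ) 1)
      (τ := fun p => p.1) (y := fun p => p.2) (by fun_prop) (by fun_prop) fun p hp => hp.1
    have h2 := hφ.continuous
    simp only [hΦ]
    fun_prop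
  · intro x _
    simp only [hΦ, sub_self, mul_zero]
    linarith
  · intro t ht x _ heq hmax
    have htI := Ioo_subset_Icc_self ht
    have hmax' : ∀ y, Φ t y ≤ 0 := fun y => by
      obtain ⟨k, hk⟩ := exists_add_mem_cube y
      rw [← hper t htI y k]; exact hmax _ (cube_subset_Icc hk)
    have htest := second_deriv_test_sign (h.cd t htI) hφ hσ0 (x := x) fun y => by
      have := hmax' y
      simp only [hΦ] at this heq
      linarith
    refine ⟨σ * mvRhs W (ρ t) x - C, ?_, ?_⟩
    · have hsum : σ * mvRhs W (ρ t) x ≤ ∑ _i : Fin d, (G₂ + K * K * G₁ + K * (K * K)) := by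
        rw [mvRhs, Finset.mul_sum]
        refine Finset.sum_le_sum fun i _ => ?_
        obtain ⟨h1, h2⟩ := htest i
        have h3 : σ * pd i (pd i (ρ 0)) x ≤ G₂ := by
          refine (le_abs_self _).trans ?_
          rw [abs_mul, hσ1, one_mul]; exact hG₂ i x
        have h4 : σ * (drift W (ρ t) i x * pd i (ρ t) x) ≤ K * K * G₁ := by
          refine (le_abs_self _).trans ?_
          rw [abs_mul, hσ1, one_mul, abs_mul, h1]
          gcongr
          exacts [h.abs_drift_le htI i x, hG₁ i x]
        have h5 : σ * (ρ t x * driftDeriv W (ρ t) i x) ≤ K * (K * K) := by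
          refine (le_abs_self _).trans ?_
          rw [abs_mul, hσ1, one_mul, abs_mul]
          gcongr
          exacts [h.bound t htI x, h.abs_driftDeriv_le htI i x]
        linarith
      simp only [Finset.sum_const, Finset.card_univ, Fintype.card_fin, nsmul_eq_mul] at hsum
      rw [hC]
      linarith
    · have h1 := (((h.hasDeriv t ht x).sub_const (ρ 0 x)).const_mul σ).sub
        ((hasDerivAt_id t).const_mul C)
      simpa [hΦ] using h1.sub_const ε

lemma exists_time_lipschitz (h : BoundedSol T K W ρ) (hT : 0 < T) :
    ∃ C, 0 ≤ C ∧ ∀ δ > 0, ∀ t, 0 ≤ t → t < T - δ → ∀ x, |ρ (t + δ) x - ρ t x| ≤ C * δ := by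
  have hK := h.K_nonneg
  obtain ⟨G, hG0, hG⟩ := h.exists_pd_bound hT
  obtain ⟨C, hC0, hC⟩ := h.exists_initial_time_bound hT
  set M := C + 1 with hM
  set lam : ℝ := d * (K * G + 2 * K ^ 2) + 1 with hlam
  have hlam0 : 0 ≤ lam := by positivity
  refine ⟨exp (lam * T) * M, by positivity, fun δ hδ t₀ ht₀ ht₀' x₀ => ?_⟩
  set Φ : ℝ → ℝ × (Fin d → ℝ) → ℝ := fun t p =>
    p.1 * (ρ (t + δ) p.2 - ρ t p.2) - exp (lam * t) * (M * δ) with hΦ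
  have hmem : ∀ t ∈ Icc 0 (T - δ), t ∈ Icc 0 T ∧ t + δ ∈ Icc 0 T := fun t ht =>
    ⟨⟨ht.1, by linarith [ht.2]⟩, ⟨by linarith [ht.1], by linarith [ht.2]⟩⟩
  have hglob : ∀ t ∈ Icc 0 (T - δ), (∀ p ∈ ({1, -1} : Set ℝ) ×ˢ Icc (0 : Fin d → ℝ) 1, Φ t p ≤ 0) →
      ∀ y, |ρ (t + δ) y - ρ t y| ≤ exp (lam * t) * (M * δ) := fun t ht hp y => by
    obtain ⟨k, hk⟩ := exists_add_mem_cube y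
    have h1 := hp (1, _) ⟨by simp, cube_subset_Icc hk⟩
    have h2 := hp (-1, _) ⟨by simp, cube_subset_Icc hk⟩
    simp only [hΦ, h.per t (hmem t ht).1 y k, h.per _ (hmem t ht).2 y k] at h1 h2
    rw [abs_le]; constructor <;> linarith
  have hm0 : t₀ ∈ Ico 0 (T - δ) := ⟨ht₀, ht₀'⟩
  have key := neg_of_first_touching (T := T - δ) (isCompact_sign.prod
    (isCompact_Icc (a := (0 : Fin d → ℝ)) (b := 1))) Φ ?_ ?_ ?_
  · refine (hglob t₀ (Ico_subset_Icc_self hm0) (fun p hp => (key t₀ hm0 p hp).le) x₀).trans ?_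
    rw [mul_assoc]
    gcongr
    linarith
  · have h1 := h.continuousOn_comp
      (S := Icc 0 (T - δ) ×ˢ (({1, -1} : Set ℝ) ×ˢ Icc (0 : Fin d → ℝ) 1))
      (τ := fun p => p.1) (y := fun p => p.2.2) (by fun_prop) (by fun_prop)
      fun p hp => (hmem _ hp.1).1
    have h2 := h.continuousOn_comp
      (S := Icc 0 (T - δ) ×ˢ (({1, -1} : Set ℝ) ×ˢ Icc (0 : Fin d → ℝ) 1))
      (τ := fun p => p.1 + δ) (y := fun p => p.2.2) (by fun_prop) (by fun_prop)
      fun p hp => (hmem _ hp.1).2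
    exact (continuous_snd.fst.continuousOn.mul (h2.sub h1)).sub
      (Continuous.continuousOn (by fun_prop))
  · rintro ⟨σ, x⟩ ⟨hσ, -⟩
    have h1 := abs_le.1 (hC δ ⟨hδ.le, by linarith⟩ x)
    have h2 : C * δ < M * δ := by gcongr; linarith
    simp only [hΦ, zero_add, mul_zero, exp_zero, one_mul]
    rcases hσ with h | h <;> (simp only at h; rw [h]; linarith)
  · rintro t ht ⟨σ, x⟩ ⟨hσ, -⟩ heq hmax
    obtain ⟨htI, htI'⟩ := hmem t (Ioo_subset_Icc_self ht)
    have hD := hglob t (Ioo_subset_Icc_self ht) hmax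
    set D := exp (lam * t) * (M * δ) with hDdef
    have hDpos : 0 < D := by positivity
    have hσ0 : σ ≠ 0 := by rcases hσ with h | h <;> (simp only at h; rw [h]; norm_num)
    have hσ1 : |σ| = 1 := by rcases hσ with h | h <;> (simp only at h; rw [h]; norm_num)
    have htest := second_deriv_test_sign (h.cd _ htI') (h.cd t htI) hσ0 (x := x) fun y => by
      simp only [hΦ] at heq
      have h1 : σ * (ρ (t + δ) y - ρ t y) ≤ D := by
        refine (le_abs_self _).trans ?_
        rw [abs_mul, hσ1, one_mul]; exact hD y
      linarith
    refine ⟨σ * (mvRhs W (ρ (t + δ)) x - mvRhs W (ρ t) x) - exp (lam * t) * lam * (M * δ), ?_, ?_⟩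
    · have hsum : σ * (mvRhs W (ρ (t + δ)) x - mvRhs W (ρ t) x) ≤
          ∑ _i : Fin d, (K * G + 2 * K ^ 2) * D := by
        rw [mvRhs, mvRhs, ← Finset.sum_sub_distrib, Finset.mul_sum]
        refine Finset.sum_le_sum fun i _ => ?_
        obtain ⟨h1, h2⟩ := htest i
        have h3 : σ * ((drift W (ρ (t + δ)) i x - drift W (ρ t) i x) * pd i (ρ t) x) ≤
            K * D * G := by
          refine (le_abs_self _).trans ?_
          rw [abs_mul, hσ1, one_mul, abs_mul]
          gcongr
          exacts [h.abs_drift_sub_le htI htI' hD i x, hG t ⟨ht.1.le, by linarith [ht.2]⟩ i x]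
        have h4 : σ * (ρ (t + δ) x * driftDeriv W (ρ (t + δ)) i x -
            ρ t x * driftDeriv W (ρ t) i x) ≤ 2 * K ^ 2 * D := by
          refine (le_abs_self _).trans ?_
          rw [abs_mul, hσ1, one_mul]
          simpa using h.mul_driftDeriv_sub_le htI htI' (z := 0) (by simpa using hD) i x
        rw [h1]
        linarith
      simp only [Finset.sum_const, Finset.card_univ, Fintype.card_fin, nsmul_eq_mul] at hsum
      have : exp (lam * t) * lam * (M * δ) = lam * D := by rw [hDdef]; ring
      rw [this, hlam]
      linarith
    · have hexp : HasDerivAt (fun s => exp (lam * s)) (exp (lam * t) * lam) t := by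
        simpa using ((hasDerivAt_id t).const_mul lam).exp
      have h1 : HasDerivAt (fun s => ρ (s + δ) x) (mvRhs W (ρ (t + δ)) x) t :=
        (h.hasDeriv (t + δ) ⟨by linarith [ht.1], by linarith [ht.2]⟩ x).comp_add_const t δ
      exact ((h1.sub (h.hasDeriv t (Ioo_subset_Ioo_right (by linarith) ht) x)).const_mul σ).sub
        (hexp.mul_const _)

lemma exists_mvRhs_bound (h : BoundedSol T K W ρ) (hT : 0 < T) :
    ∃ C, 0 ≤ C ∧ ∀ t ∈ Ioo 0 T, ∀ x, |mvRhs W (ρ t) x| ≤ C := by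
  obtain ⟨C, hC0, hC⟩ := h.exists_time_lipschitz hT
  refine ⟨C, hC0, fun t ht x => ?_⟩
  refine (h.hasDeriv t ht x).le_of_lip' hC0 ?_
  filter_upwards [Ioo_mem_nhds ht.1 ht.2] with s hs
  rw [norm_eq_abs, norm_eq_abs]
  rcases lt_trichotomy s t with hst | rfl | hst
  · have := hC (t - s) (by linarith) s hs.1.le (by linarith [ht.2]) x
    rw [add_sub_cancel] at this
    rwa [abs_sub_comm, abs_sub_comm s, abs_of_pos (sub_pos.2 hst)]
  · simp
  · have := hC (s - t) (by linarith) t ht.1.le (by linarith [hs.2]) x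
    rw [add_sub_cancel] at this
    rwa [abs_of_pos (sub_pos.2 hst)]

end BoundedSol

/-- A potential and a density of the regularity of a classical solution at a fixed time. -/
structure RegularPair (W p : (Fin d → ℝ) → ℝ) : Prop where
  smoothW : ContDiff ℝ 2 W
  perW : ZdPeriodic W
  smooth : ContDiff ℝ 2 p
  per : ZdPeriodic p
  pos : ∀ x, 0 < p x

namespace RegularPair

variable {W W₁ W₂ p q : (Fin d → ℝ) → ℝ}

lemma differentiable (h : RegularPair W p) : Differentiable ℝ p :=
  h.smooth.differentiable two_ne_zero

lemma differentiable_pd (h : RegularPair W p) (i : Fin d) : Differentiable ℝ (pd i p) :=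
  (contDiff_pd h.smooth i).differentiable one_ne_zero

lemma differentiable_drift (h : RegularPair W p) (i : Fin d) : Differentiable ℝ (drift W p i) :=
  fun x => (hasFDerivAt_pconv (contDiff_pd h.smoothW i) (h.perW.pd i) h.smooth.continuous h.per
    x).differentiableAt

lemma pd_drift (h : RegularPair W p) (i : Fin d) : pd i (drift W p i) = driftDeriv W p i :=
  pd_pconv (contDiff_pd h.smoothW i) (h.perW.pd i) h.smooth.continuous h.per i

lemma per_drift (h : RegularPair W p) (i : Fin d) : ZdPeriodic (drift W p i) :=
  (h.perW.pd i).pconv p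

lemma continuous_driftDeriv (h : RegularPair W p) (i : Fin d) : Continuous (driftDeriv W p i) :=
  continuous_pconv (continuous_pd (contDiff_pd h.smoothW i) i) ((h.perW.pd i).pd i)
    h.smooth.continuous h.per

lemma continuous_pd₁ (h : RegularPair W p) (i : Fin d) : Continuous (pd i p) :=
  (h.differentiable_pd i).continuous

lemma continuous_pd₂ (h : RegularPair W p) (i : Fin d) : Continuous (pd i (pd i p)) :=
  continuous_pd (contDiff_pd h.smooth i) i

lemma continuous_drift (h : RegularPair W p) (i : Fin d) : Continuous (drift W p i) :=
  (h.differentiable_drift i).continuous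

lemma continuous_mvRhs (h : RegularPair W p) : Continuous (mvRhs W p) :=
  continuous_finsetSum _ fun i _ => ((h.continuous_pd₂ i).add
    ((h.continuous_drift i).mul (h.continuous_pd₁ i))).add
      (h.smooth.continuous.mul (h.continuous_driftDeriv i))

/-- The flux whose divergence is the exact part of the entropy production. -/
def flux (W₁ W₂ p q : (Fin d → ℝ) → ℝ) (i : Fin d) (x : Fin d → ℝ) : ℝ :=
  (pd i p x + p x * drift W₁ p i x) * (log (p x) - log (q x) + 1) -
    p x / q x * (pd i q x + q x * drift W₂ q i x)

lemma differentiable_flux (hp : RegularPair W₁ p) (hq : RegularPair W₂ q) (i : Fin d) :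
    Differentiable ℝ (flux W₁ W₂ p q i) := by
  have hp0 := fun x => (hp.pos x).ne'
  have hq0 := fun x => (hq.pos x).ne'
  exact (((hp.differentiable_pd i).add (hp.differentiable.mul (hp.differentiable_drift i))).mul
    (((hp.differentiable.log hp0).sub (hq.differentiable.log hq0)).add_const 1)).sub
    ((hp.differentiable.mul (hq.differentiable.inv hq0)).mul
      ((hq.differentiable_pd i).add (hq.differentiable.mul (hq.differentiable_drift i))))

lemma per_flux (hp : RegularPair W₁ p) (hq : RegularPair W₂ q) (i : Fin d) :
    ZdPeriodic (flux W₁ W₂ p q i) := fun x k => by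
  simp only [flux, hp.per x k, hq.per x k, hp.per.pd i x k, hq.per.pd i x k, hp.per_drift i x k,
    hq.per_drift i x k]

lemma pd_flux (hp : RegularPair W₁ p) (hq : RegularPair W₂ q) (i : Fin d) :
    pd i (flux W₁ W₂ p q i) = fun x =>
      (pd i (pd i p) x + (pd i p x * drift W₁ p i x + p x * driftDeriv W₁ p i x)) *
        (log (p x) - log (q x) + 1) +
      (pd i p x + p x * drift W₁ p i x) * (pd i p x / p x - pd i q x / q x) -
      ((pd i p x * q x - p x * pd i q x) / q x ^ 2 * (pd i q x + q x * drift W₂ q i x) +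
        p x / q x *
          (pd i (pd i q) x + (pd i q x * drift W₂ q i x + q x * driftDeriv W₂ q i x))) := by
  funext x
  have hp1 := hasDerivAt_pd i (hp.differentiable x)
  have hq1 := hasDerivAt_pd i (hq.differentiable x)
  have hp2 := hasDerivAt_pd i (hp.differentiable_pd i x)
  have hq2 := hasDerivAt_pd i (hq.differentiable_pd i x)
  have hp3 := hasDerivAt_pd i (hp.differentiable_drift i x)
  have hq3 := hasDerivAt_pd i (hq.differentiable_drift i x)
  have h1 := ((hp2.fun_add (hp1.fun_mul hp3)).fun_mul (((hp1.log (hp.pos _).ne').fun_sub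
    (hq1.log (hq.pos _).ne')).add_const 1)).fun_sub ((hp1.fun_div hq1 (hq.pos _).ne').fun_mul
      (hq2.fun_add (hq1.fun_mul hq3)))
  have h2 := (hasDerivAt_pd i (differentiable_flux hp hq i x)).unique h1
  simpa only [zero_smul, add_zero, hp.pd_drift, hq.pd_drift] using h2

lemma continuous_pd_flux (hp : RegularPair W₁ p) (hq : RegularPair W₂ q) (i : Fin d) :
    Continuous (pd i (flux W₁ W₂ p q i)) := by
  have hp0 := fun x => (hp.pos x).ne'
  have hq0 := fun x => (hq.pos x).ne'
  have := hp.smooth.continuous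
  have := hq.smooth.continuous
  have := hp.continuous_pd₁ i
  have := hq.continuous_pd₁ i
  have := hp.continuous_pd₂ i
  have := hq.continuous_pd₂ i
  have := hp.continuous_drift i
  have := hq.continuous_drift i
  have := hp.continuous_driftDeriv i
  have := hq.continuous_driftDeriv i
  rw [pd_flux hp hq]
  fun_prop (disch := first | assumption | (intro x; exact pow_ne_zero 2 (hq0 x)))

/-- The time derivative of `p log (p / q)` when `p` and `q` evolve by `mvRhs`. -/
def entropyRate (W₁ W₂ p q : (Fin d → ℝ) → ℝ) (x : Fin d → ℝ) : ℝ :=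
  mvRhs W₁ p x * (log (p x / q x) + 1) - p x / q x * mvRhs W₂ q x

lemma continuous_div (hp : RegularPair W₁ p) (hq : RegularPair W₂ q) :
    Continuous fun x => p x / q x :=
  hp.smooth.continuous.div hq.smooth.continuous fun x => (hq.pos x).ne'

lemma continuous_log_div (hp : RegularPair W₁ p) (hq : RegularPair W₂ q) :
    Continuous fun x => log (p x / q x) :=
  (continuous_div hp hq).log fun x => (div_pos (hp.pos x) (hq.pos x)).ne'

lemma continuous_entropyRate (hp : RegularPair W₁ p) (hq : RegularPair W₂ q) :
    Continuous (entropyRate W₁ W₂ p q) :=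
  (hp.continuous_mvRhs.mul ((continuous_log_div hp hq).add continuous_const)).sub
    ((continuous_div hp hq).mul hq.continuous_mvRhs)

/-- The squared drift difference, weighted by the first density. -/
def driftGap (W₁ W₂ p q : (Fin d → ℝ) → ℝ) (x : Fin d → ℝ) : ℝ :=
  (∑ i, (drift W₁ p i x - drift W₂ q i x) ^ 2) * p x

lemma continuous_driftGap (hp : RegularPair W₁ p) (hq : RegularPair W₂ q) :
    Continuous (driftGap W₁ W₂ p q) :=
  (continuous_finsetSum _ fun i _ =>
    ((hp.continuous_drift i).sub (hq.continuous_drift i)).pow 2).mul hp.smooth.continuous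

lemma entropyRate_le (hp : RegularPair W₁ p) (hq : RegularPair W₂ q) (x : Fin d → ℝ) :
    entropyRate W₁ W₂ p q x ≤
      ∑ i, pd i (flux W₁ W₂ p q i) x + 1 / 2 * driftGap W₁ W₂ p q x := by
  have hp0 := hp.pos x
  have hq0 := hq.pos x
  rw [entropyRate, driftGap, mvRhs, mvRhs, log_div hp0.ne' hq0.ne', Finset.sum_mul,
    Finset.mul_sum, ← Finset.sum_sub_distrib, Finset.sum_mul, Finset.mul_sum,
    ← Finset.sum_add_distrib]
  refine Finset.sum_le_sum fun i _ => ?_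
  simp only [pd_flux hp hq]
  set v := pd i p x / p x - pd i q x / q x with hv
  have h1 : (pd i p x * q x - p x * pd i q x) / q x ^ 2 * (pd i q x + q x * drift W₂ q i x) =
      p x * v * (pd i q x / q x + drift W₂ q i x) := by
    rw [hv]; field_simp
  have h2 : (pd i p x + p x * drift W₁ p i x) * v =
      p x * v * (pd i p x / p x + drift W₁ p i x) := by
    rw [hv]; field_simp
  have h3 : 0 ≤ p x * (v ^ 2 + v * (drift W₁ p i x - drift W₂ q i x) +
      1 / 2 * (drift W₁ p i x - drift W₂ q i x) ^ 2) := by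
    refine mul_nonneg hp0.le ?_
    nlinarith [sq_nonneg (v + (drift W₁ p i x - drift W₂ q i x)), sq_nonneg v]
  rw [h1, h2]
  have h4 : pd i p x / p x = v + pd i q x / q x := by rw [hv]; ring
  rw [h4]
  nlinarith [h3]

/-- Entropy production is controlled by the drift difference. -/
lemma integral_entropyRate_le (hp : RegularPair W₁ p) (hq : RegularPair W₂ q) :
    ∫ x in cube d, entropyRate W₁ W₂ p q x ≤ 1 / 2 * ∫ x in cube d, driftGap W₁ W₂ p q x := by
  have hF := fun i => continuous_pd_flux hp hq i
  have hG := continuous_driftGap hp hq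
  calc ∫ x in cube d, entropyRate W₁ W₂ p q x
      ≤ ∫ x in cube d, (∑ i, pd i (flux W₁ W₂ p q i) x + 1 / 2 * driftGap W₁ W₂ p q x) :=
        integral_mono (integrable_cube (continuous_entropyRate hp hq))
          (integrable_cube (by fun_prop)) (entropyRate_le hp hq)
    _ = _ := by
      rw [integral_add (integrable_cube (by fun_prop)) (integrable_cube (by fun_prop)),
        integral_finsetSum _ fun i _ => integrable_cube (hF i), integral_const_mul]
      simp [integral_pd_eq_zero (per_flux hp hq _) _ (differentiable_flux hp hq _) (hF _)]

end RegularPair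

lemma continuousOn_integral_cube {f : ℝ → (Fin d → ℝ) → ℝ} {s : Set ℝ} {C : ℝ}
    (hc : ∀ t ∈ s, Continuous (f t)) (hb : ∀ t ∈ s, ∀ x ∈ cube d, |f t x| ≤ C)
    (ht : ∀ x, ContinuousOn (fun t => f t x) s) :
    ContinuousOn (fun t => ∫ x in cube d, f t x) s :=
  continuousOn_of_dominated (bound := fun _ => C) (fun t h => (hc t h).aestronglyMeasurable)
    (fun t h => ae_restrict_of_forall_mem measurableSet_cube (hb t h)) (integrable_const C)
    (.of_forall ht)

namespace BoundedSol

variable {T K K₁ K₂ : ℝ} {W W₁ W₂ : (Fin d → ℝ) → ℝ} {ρ ρ₁ ρ₂ : ℝ → (Fin d → ℝ) → ℝ}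

lemma regularPair (h : BoundedSol T K W ρ) {t : ℝ} (ht : t ∈ Icc 0 T) (hpos : ∀ x, 0 < ρ t x) :
    RegularPair W (ρ t) :=
  ⟨h.smooth, h.perW, h.cd t ht, h.per t ht, hpos⟩

lemma continuousOn_time (h : BoundedSol T K W ρ) (x : Fin d → ℝ) :
    ContinuousOn (fun t => ρ t x) (Icc 0 T) :=
  h.continuousOn_comp continuousOn_id continuousOn_const fun _ ht => ht

lemma continuousOn_drift (h : BoundedSol T K W ρ) (i : Fin d) (x : Fin d → ℝ) :
    ContinuousOn (fun t => drift W (ρ t) i x) (Icc 0 T) := by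
  have hW := (contDiff_pd h.smooth i).continuous
  refine continuousOn_integral_cube (C := K * K) (fun t ht => ?_) (fun t ht y _ => ?_) fun y => ?_
  · have := (h.cd t ht).continuous
    fun_prop
  · rw [abs_mul]
    exact mul_le_mul (h.boundW₁ i _) (h.bound t ht y) (abs_nonneg _) h.K_nonneg
  · exact continuousOn_const.mul (h.continuousOn_time y)

lemma continuousOn_integral_driftGap (h₁ : BoundedSol T K₁ W₁ ρ₁) (h₂ : BoundedSol T K₂ W₂ ρ₂)
    (hpos₁ : ∀ t ∈ Icc 0 T, ∀ x, 0 < ρ₁ t x) (hpos₂ : ∀ t ∈ Icc 0 T, ∀ x, 0 < ρ₂ t x) :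
    ContinuousOn (fun t => ∫ x in cube d, RegularPair.driftGap W₁ W₂ (ρ₁ t) (ρ₂ t) x)
      (Icc 0 T) := by
  refine continuousOn_integral_cube (C := (∑ _i : Fin d, (K₁ * K₁ + K₂ * K₂) ^ 2) * K₁)
    (fun t ht => ?_) (fun t ht x _ => ?_) fun x => ?_
  · exact RegularPair.continuous_driftGap (h₁.regularPair ht (hpos₁ t ht))
      (h₂.regularPair ht (hpos₂ t ht))
  · rw [RegularPair.driftGap, abs_mul]
    refine mul_le_mul ?_ (h₁.bound t ht x) (abs_nonneg _) (by positivity)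
    refine (Finset.abs_sum_le_sum_abs _ _).trans (Finset.sum_le_sum fun i _ => ?_)
    rw [abs_pow]
    exact pow_le_pow_left₀ (abs_nonneg _) ((abs_sub _ _).trans
      (add_le_add (h₁.abs_drift_le ht i x) (h₂.abs_drift_le ht i x))) 2
  · exact (continuousOn_finsetSum _ fun i _ =>
      ((h₁.continuousOn_drift i x).sub (h₂.continuousOn_drift i x)).pow 2).mul
        (h₁.continuousOn_time x)

lemma exists_ratio_bound (h₁ : BoundedSol T K₁ W₁ ρ₁) (h₂ : BoundedSol T K₂ W₂ ρ₂)
    (hpos₁ : ∀ t ∈ Icc 0 T, ∀ x, 0 < ρ₁ t x) (hpos₂ : ∀ t ∈ Icc 0 T, ∀ x, 0 < ρ₂ t x) :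
    ∃ L, 0 ≤ L ∧ ∀ t ∈ Icc 0 T, ∀ x ∈ cube d,
      |ρ₁ t x / ρ₂ t x| ≤ L ∧ |log (ρ₁ t x / ρ₂ t x)| ≤ L := by
  have hK : IsCompact (Icc 0 T ×ˢ Icc (0 : Fin d → ℝ) 1) := isCompact_Icc.prod isCompact_Icc
  have hc : ∀ {K W ρ}, BoundedSol T K W ρ → ContinuousOn (fun p : ℝ × (Fin d → ℝ) => ρ p.1 p.2)
      (Icc 0 T ×ˢ Icc (0 : Fin d → ℝ) 1) := fun h =>
    h.cont.mono (prod_mono_right (subset_univ _))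
  have hr := (hc h₁).div (hc h₂) fun p hp => (hpos₂ _ hp.1 p.2).ne'
  have hl := hr.log fun p hp => (div_pos (hpos₁ _ hp.1 p.2) (hpos₂ _ hp.1 p.2)).ne'
  obtain ⟨A, hA⟩ := hK.exists_bound_of_continuousOn hr
  obtain ⟨B, hB⟩ := hK.exists_bound_of_continuousOn hl
  refine ⟨max 0 (max A B), le_max_left _ _, fun t ht x hx => ⟨?_, ?_⟩⟩
  · exact (hA (t, x) ⟨ht, cube_subset_Icc hx⟩).trans
      ((le_max_left _ _).trans (le_max_right _ _))
  · exact (hB (t, x) ⟨ht, cube_subset_Icc hx⟩).trans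
      ((le_max_right _ _).trans (le_max_right _ _))

lemma continuousOn_relEnt (h₁ : BoundedSol T K₁ W₁ ρ₁) (h₂ : BoundedSol T K₂ W₂ ρ₂)
    (hpos₁ : ∀ t ∈ Icc 0 T, ∀ x, 0 < ρ₁ t x) (hpos₂ : ∀ t ∈ Icc 0 T, ∀ x, 0 < ρ₂ t x) :
    ContinuousOn (fun t => relEnt (ρ₁ t) (ρ₂ t)) (Icc 0 T) := by
  obtain ⟨L, hL0, hL⟩ := exists_ratio_bound h₁ h₂ hpos₁ hpos₂
  refine continuousOn_integral_cube (C := K₁ * L) (fun t ht => ?_) (fun t ht x hx => ?_)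
    fun x => ?_
  · exact (h₁.cd t ht).continuous.mul (RegularPair.continuous_log_div
      (h₁.regularPair ht (hpos₁ t ht)) (h₂.regularPair ht (hpos₂ t ht)))
  · rw [abs_mul]
    exact mul_le_mul (h₁.bound t ht x) (hL t ht x hx).2 (abs_nonneg _) h₁.K_nonneg
  · exact (h₁.continuousOn_time x).mul (((h₁.continuousOn_time x).div (h₂.continuousOn_time x)
      fun t ht => (hpos₂ t ht x).ne').log
        fun t ht => (div_pos (hpos₁ t ht x) (hpos₂ t ht x)).ne')

lemma hasDerivAt_relEnt (h₁ : BoundedSol T K₁ W₁ ρ₁) (h₂ : BoundedSol T K₂ W₂ ρ₂)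
    (hpos₁ : ∀ t ∈ Icc 0 T, ∀ x, 0 < ρ₁ t x) (hpos₂ : ∀ t ∈ Icc 0 T, ∀ x, 0 < ρ₂ t x)
    {t : ℝ} (ht : t ∈ Ioo 0 T) :
    HasDerivAt (fun s => relEnt (ρ₁ s) (ρ₂ s))
      (∫ x in cube d, RegularPair.entropyRate W₁ W₂ (ρ₁ t) (ρ₂ t) x) t := by
  have hT : 0 < T := ht.1.trans ht.2
  obtain ⟨L, hL0, hL⟩ := exists_ratio_bound h₁ h₂ hpos₁ hpos₂
  obtain ⟨C₁, hC₁0, hC₁⟩ := h₁.exists_mvRhs_bound hT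
  obtain ⟨C₂, hC₂0, hC₂⟩ := h₂.exists_mvRhs_bound hT
  have hreg : ∀ s ∈ Ioo 0 T, RegularPair W₁ (ρ₁ s) ∧ RegularPair W₂ (ρ₂ s) := fun s hs =>
    ⟨h₁.regularPair (Ioo_subset_Icc_self hs) (hpos₁ s (Ioo_subset_Icc_self hs)),
      h₂.regularPair (Ioo_subset_Icc_self hs) (hpos₂ s (Ioo_subset_Icc_self hs))⟩
  have hcont : ∀ s ∈ Ioo 0 T, Continuous fun x => ρ₁ s x * log (ρ₁ s x / ρ₂ s x) := fun s hs =>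
    (hreg s hs).1.smooth.continuous.mul
      (RegularPair.continuous_log_div (hreg s hs).1 (hreg s hs).2)
  have hnhds : Ioo 0 T ∈ 𝓝 t := Ioo_mem_nhds ht.1 ht.2
  refine (hasDerivAt_integral_of_dominated_loc_of_deriv_le
    (μ := volume.restrict (cube d)) (F := fun s x => ρ₁ s x * log (ρ₁ s x / ρ₂ s x))
    (F' := fun s => RegularPair.entropyRate W₁ W₂ (ρ₁ s) (ρ₂ s))
    (bound := fun _ => C₁ * (L + 1) + L * C₂) hnhds ?_ ?_ ?_ ?_ ?_ ?_).2
  · filter_upwards [hnhds] with s hs using (hcont s hs).aestronglyMeasurable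
  · exact integrable_cube (hcont t ht)
  · exact (RegularPair.continuous_entropyRate (hreg t ht).1 (hreg t ht).2).aestronglyMeasurable
  · refine ae_restrict_of_forall_mem measurableSet_cube fun x hx s hs => ?_
    obtain ⟨hr, hl⟩ := hL s (Ioo_subset_Icc_self hs) x hx
    refine (abs_sub _ _).trans (add_le_add ?_ ?_)
    · rw [abs_mul]
      refine mul_le_mul (hC₁ s hs x) ((abs_add_le _ _).trans ?_) (abs_nonneg _) hC₁0
      simpa using hl
    · rw [abs_mul]
      exact mul_le_mul hr (hC₂ s hs x) (abs_nonneg _) hL0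
  · exact integrable_const _
  · refine .of_forall fun x s hs => ?_
    have hp := (hreg s hs).1.pos x
    have hq := (hreg s hs).2.pos x
    have hp' := h₁.hasDeriv s hs x
    have hq' := h₂.hasDeriv s hs x
    refine (hp'.fun_mul ((hp'.fun_div hq' hq.ne').log (div_pos hp hq).ne')).congr_deriv ?_
    rw [RegularPair.entropyRate]
    field_simp
    ring

lemma relEnt_sub_le (h₁ : BoundedSol T K₁ W₁ ρ₁) (h₂ : BoundedSol T K₂ W₂ ρ₂)
    (hpos₁ : ∀ t ∈ Icc 0 T, ∀ x, 0 < ρ₁ t x) (hpos₂ : ∀ t ∈ Icc 0 T, ∀ x, 0 < ρ₂ t x)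
    {t : ℝ} (ht : t ∈ Icc 0 T) :
    relEnt (ρ₁ t) (ρ₂ t) - relEnt (ρ₁ 0) (ρ₂ 0) ≤ 1 / 2 *
      ∫ u in Ioc 0 t, ∫ x in cube d, RegularPair.driftGap W₁ W₂ (ρ₁ u) (ρ₂ u) x := by
  have hsub : Icc 0 t ⊆ Icc 0 T := Icc_subset_Icc_right ht.2
  have hR := (continuousOn_integral_driftGap h₁ h₂ hpos₁ hpos₂).mono hsub
  rw [← intervalIntegral.integral_of_le ht.1, ← intervalIntegral.integral_const_mul]
  refine intervalIntegral.sub_le_integral_of_hasDeriv_right_of_le ht.1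
    ((continuousOn_relEnt h₁ h₂ hpos₁ hpos₂).mono hsub)
    (fun s hs => (hasDerivAt_relEnt h₁ h₂ hpos₁ hpos₂
      (Ioo_subset_Ioo_right ht.2 hs)).hasDerivWithinAt)
    (continuousOn_const.mul hR).integrableOn_Icc fun s hs => ?_
  have hs' := hsub (Ioo_subset_Icc_self hs)
  exact RegularPair.integral_entropyRate_le (h₁.regularPair hs' (hpos₁ s hs'))
    (h₂.regularPair hs' (hpos₂ s hs'))

end BoundedSol

end

/-- relative entropy bound between two McKean–Vlasov solutions with
different interaction potentials and common initial density. -/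
theorem mv_relative_entropy_bound
    (d : ℕ) (hd : 1 ≤ d) (T : ℝ) (hT : 0 < T)
    (W₁ W₂ φ : (Fin d → ℝ) → ℝ)
    (hW₁smooth : ContDiff ℝ 2 W₁) (hW₁per : ZdPeriodic W₁)
    (hW₂smooth : ContDiff ℝ 2 W₂) (hW₂per : ZdPeriodic W₂)
    (ρ₁ ρ₂ : ℝ → (Fin d → ℝ) → ℝ)
    (hρ₁ : IsMVSolution T W₁ φ ρ₁) (hρ₂ : IsMVSolution T W₂ φ ρ₂)
    (hρ₁pos : ∀ t ∈ Set.Icc (0:ℝ) T, ∀ x, 0 < ρ₁ t x)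
    (hρ₂pos : ∀ t ∈ Set.Icc (0:ℝ) T, ∀ x, 0 < ρ₂ t x)
    (hρ₁cont : ContinuousOn (fun p : ℝ × (Fin d → ℝ) => ρ₁ p.1 p.2)
      (Set.Icc (0:ℝ) T ×ˢ (Set.univ : Set (Fin d → ℝ))))
    (hρ₂cont : ContinuousOn (fun p : ℝ × (Fin d → ℝ) => ρ₂ p.1 p.2)
      (Set.Icc (0:ℝ) T ×ˢ (Set.univ : Set (Fin d → ℝ)))) :
    ∀ t ∈ Set.Icc (0:ℝ) T,
      relEnt (ρ₁ t) (ρ₂ t) ≤ (1/2) *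
        ∫ u in Set.Ioc (0:ℝ) t, ∫ x in cube d,
          (∑ i, (pd i (pconv W₁ (ρ₁ u)) x - pd i (pconv W₂ (ρ₂ u)) x) ^ 2) * ρ₁ u x := by
  intro t ht
  obtain ⟨K₁, h₁⟩ := hρ₁.exists_boundedSol hW₁smooth hW₁per hρ₁cont
  obtain ⟨K₂, h₂⟩ := hρ₂.exists_boundedSol hW₂smooth hW₂per hρ₂cont
  have hφ : ∀ x, φ x ≠ 0 := fun x => by
    have := hρ₁pos 0 ⟨le_rfl, hT.le⟩ x
    rw [hρ₁.2.2.2.1] at this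
    exact this.ne'
  have h0 : relEnt (ρ₁ 0) (ρ₂ 0) = 0 := by
    simp [relEnt, hρ₁.2.2.2.1, hρ₂.2.2.2.1, div_self (hφ _)]
  have key := BoundedSol.relEnt_sub_le h₁ h₂ hρ₁pos hρ₂pos ht
  rw [h0, sub_zero] at key
  refine key.trans_eq (congrArg _ (setIntegral_congr_fun measurableSet_Ioc fun u hu => ?_))
  have hu' : u ∈ Set.Icc 0 T := ⟨hu.1.le, hu.2.trans ht.2⟩
  simp only [RegularPair.driftGap, drift,
    pd_pconv (hW₁smooth.of_le one_le_two) hW₁per (h₁.cd u hu').continuous (h₁.per u hu'),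
    pd_pconv (hW₂smooth.of_le one_le_two) hW₂per (h₂.cd u hu').continuous (h₂.per u hu')]
end
end

section
/- Let (X, 𝒜, μ) be a measure space and let p, q : X → [0,∞) be probability densities with respect to μ (i.e. measurable, nonnegative, with ∫ p dμ = ∫ q dμ = 1) such that p ≤ B and q ≤ B μ-almost everywhere for some B > 0, and q > 0 μ-almost everywhere. Then ∫_X (p − q)² dμ ≤ 4B ∫_X p log(p/q) dμ. -/
open MeasureTheory
noncomputable section

/-- The squared Hellinger integrand is dominated by the (nonnegative) KL integrand. -/
lemma sq_sqrt_sub_sqrt_le_mul_log_div {a b : ℝ} (ha : 0 ≤ a) (hb : 0 < b) :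
    (√a - √b) ^ 2 ≤ a * Real.log (a / b) + b - a := by
  rcases ha.eq_or_lt with rfl | ha
  · simp [Real.sq_sqrt hb.le]
  have hsa := Real.sqrt_pos.2 ha
  have hsb := Real.sqrt_pos.2 hb
  have hlog : Real.log (a / b) = -(2 * Real.log (√b / √a)) := by
    rw [Real.log_div ha.ne' hb.ne', Real.log_div hsb.ne' hsa.ne', Real.log_sqrt ha.le,
      Real.log_sqrt hb.le]
    ring
  have hle : a * Real.log (√b / √a) ≤ a * (√b / √a - 1) :=
    mul_le_mul_of_nonneg_left (Real.log_le_sub_one_of_pos (div_pos hsb hsa)) ha.le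
  have hmul : a * (√b / √a - 1) = √a * √b - a := by
    nth_rewrite 1 [← Real.sq_sqrt ha.le]
    field_simp
    rw [mul_sub, Real.mul_self_sqrt ha.le]
  rw [hlog, sub_sq, Real.sq_sqrt ha.le, Real.sq_sqrt hb.le]
  linarith

lemma sq_sub_le_four_mul_mul_log_div {a b B : ℝ} (ha : 0 ≤ a) (hb : 0 < b)
    (haB : a ≤ B) (hbB : b ≤ B) :
    (a - b) ^ 2 ≤ 4 * B * (a * Real.log (a / b) + b - a) := by
  have hB : 0 ≤ B := ha.trans haB
  have hsum : (√a + √b) ^ 2 ≤ 4 * B := by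
    nlinarith [Real.sq_sqrt ha, Real.sq_sqrt hb.le, sq_nonneg (√a - √b)]
  calc (a - b) ^ 2 = (√a + √b) ^ 2 * (√a - √b) ^ 2 := by
        rw [← mul_pow, ← sq_sub_sq, Real.sq_sqrt ha, Real.sq_sqrt hb.le]
    _ ≤ 4 * B * (a * Real.log (a / b) + b - a) :=
        mul_le_mul hsum (sq_sqrt_sub_sqrt_le_mul_log_div ha hb) (sq_nonneg _) (by positivity)

/-- a Pinsker-type inequality: for bounded probability densities `p, q ≤ B`
with `q > 0` a.e., `∫ (p-q)² dμ ≤ 4B ∫ p log(p/q) dμ` (the right-hand side being the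
Kullback–Leibler divergence; `p log(p/q)` is `0` where `p = 0`, and we assume the
KL integrand is integrable, i.e. the divergence is finite). -/
theorem sq_dist_le_four_B_mul_KL
    {X : Type*} [MeasurableSpace X] (μ : Measure X)
    (p q : X → ℝ) (B : ℝ) (hB : 0 < B)
    (hpmeas : Measurable p) (hqmeas : Measurable q)
    (hp0 : ∀ x, 0 ≤ p x) (hq0 : ∀ x, 0 ≤ q x)
    (hpint : (∫ x, p x ∂μ) = 1) (hqint : (∫ x, q x ∂μ) = 1)
    (hpB : ∀ᵐ x ∂μ, p x ≤ B) (hqB : ∀ᵐ x ∂μ, q x ≤ B)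
    (hqpos : ∀ᵐ x ∂μ, 0 < q x)
    (hKLint : Integrable (fun x => p x * Real.log (p x / q x)) μ) :
    (∫ x, (p x - q x) ^ 2 ∂μ) ≤ 4 * B * ∫ x, p x * Real.log (p x / q x) ∂μ := by
  have hp : Integrable p μ := .of_integral_ne_zero (by simp [hpint])
  have hq : Integrable q μ := .of_integral_ne_zero (by simp [hqint])
  calc (∫ x, (p x - q x) ^ 2 ∂μ)
      ≤ ∫ x, 4 * B * (p x * Real.log (p x / q x) + q x - p x) ∂μ := by
        refine integral_mono_of_nonneg (.of_forall fun x => sq_nonneg _)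
          (((hKLint.add hq).sub hp).const_mul _) ?_
        filter_upwards [hpB, hqB, hqpos] with x hpx hqx hx
        exact sq_sub_le_four_mul_mul_log_div (hp0 x) hx hpx hqx
    _ = 4 * B * ∫ x, p x * Real.log (p x / q x) ∂μ := by
        rw [integral_const_mul, integral_sub (by exact hKLint.add hq) hp,
          integral_add hKLint hq, hpint, hqint, add_sub_cancel_right]
end
end
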